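/- arXiv:2303.06526 — 6 statements merged into one kernel-verified Lean document; each statement's English description precedes it below -/
import Mathlib

section
/- Let M ≥ 1, let p : {1,…,M} → [0,1] be a probability vector (∑_m p_m = 1), let φ : {1,…,M} → ℝ, and let η > 0 and η' > 0. Setting d = max_m φ_m − min_m φ_m, one has (1/η)·log(∑_{m=1}^M p_m·exp(−η·φ_m)) ≥ (1/η')·log(∑_{m=1}^M p_m·exp(−η'·φ_m)) − |1 − η/η'|·d. -/
section WeightedExponentialSums

variable {ι : Type*} {s : Finset ι} {p φ : ι → ℝ}

theorem exp_neg_mul_le_weighted_sum_exp (hp : ∀ m ∈ s, 0 ≤ p m) (hsum : ∑ m ∈ s, p m = 1)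
    {b η : ℝ} (hη : 0 ≤ η) (hb : ∀ m ∈ s, φ m ≤ b) :
    Real.exp (-η * b) ≤ ∑ m ∈ s, p m * Real.exp (-η * φ m) := by
  calc Real.exp (-η * b) = ∑ m ∈ s, p m * Real.exp (-η * b) := by
        rw [← Finset.sum_mul, hsum, one_mul]
    _ ≤ _ := Finset.sum_le_sum fun m hm => mul_le_mul_of_nonneg_left
        (Real.exp_le_exp.2 (by nlinarith [hb m hm])) (hp m hm)

theorem weighted_sum_exp_pos (hp : ∀ m ∈ s, 0 ≤ p m) (hsum : ∑ m ∈ s, p m = 1) (η : ℝ) :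
    0 < ∑ m ∈ s, p m * Real.exp (-η * φ m) := by
  obtain ⟨m, hm, hpm⟩ : ∃ m ∈ s, 0 < p m :=
    Finset.exists_lt_of_sum_lt (by simp [hsum])
  exact Finset.sum_pos' (fun i hi => mul_nonneg (hp i hi) (Real.exp_pos _).le)
    ⟨m, hm, mul_pos hpm (Real.exp_pos _)⟩

theorem weighted_sum_exp_le_exp_mul (hp : ∀ m ∈ s, 0 ≤ p m) {a η η' : ℝ} (h : η ≤ η')
    (ha : ∀ m ∈ s, a ≤ φ m) :
    ∑ m ∈ s, p m * Real.exp (-η' * φ m) ≤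
      Real.exp (-(η' - η) * a) * ∑ m ∈ s, p m * Real.exp (-η * φ m) := by
  rw [Finset.mul_sum]
  refine Finset.sum_le_sum fun m hm => ?_
  rw [mul_left_comm, ← Real.exp_add]
  exact mul_le_mul_of_nonneg_left (Real.exp_le_exp.2 (by nlinarith [ha m hm])) (hp m hm)

/-- The normalized log-moment is monotone in the learning rate. -/
theorem log_weighted_sum_exp_div_mono (hp : ∀ m ∈ s, 0 ≤ p m) (hsum : ∑ m ∈ s, p m = 1)
    {η η' : ℝ} (hη' : 0 < η') (h : η' ≤ η) :
    (1 / η') * Real.log (∑ m ∈ s, p m * Real.exp (-η' * φ m)) ≤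
      (1 / η) * Real.log (∑ m ∈ s, p m * Real.exp (-η * φ m)) := by
  have hη : 0 < η := hη'.trans_le h
  have hZ := weighted_sum_exp_pos (φ := φ) hp hsum η'
  have key := Real.rpow_arith_mean_le_arith_mean_rpow s p (fun m => Real.exp (-η' * φ m)) hp hsum
    (fun m _ => (Real.exp_pos _).le) ((one_le_div hη').2 h)
  have hexp (m : ι) : Real.exp (-η' * φ m) ^ (η / η') = Real.exp (-η * φ m) := by
    rw [← Real.exp_mul]
    congr 1
    field_simp
  simp only [hexp] at key
  have hlog := Real.log_le_log (Real.rpow_pos_of_pos hZ _) key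
  rw [Real.log_rpow hZ] at hlog
  calc _ = (1 / η) * (η / η' * Real.log (∑ m ∈ s, p m * Real.exp (-η' * φ m))) := by
        field_simp
    _ ≤ _ := mul_le_mul_of_nonneg_left hlog (by positivity)

/-- Decreasing the learning rate lowers the normalized log-moment by at most a multiple of the
range of `φ`. -/
theorem log_weighted_sum_exp_div_sub_le (hp : ∀ m ∈ s, 0 ≤ p m) (hsum : ∑ m ∈ s, p m = 1)
    {a b η η' : ℝ} (hη : 0 < η) (h : η ≤ η') (ha : ∀ m ∈ s, a ≤ φ m) (hb : ∀ m ∈ s, φ m ≤ b) :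
    (1 / η') * Real.log (∑ m ∈ s, p m * Real.exp (-η' * φ m)) - (1 - η / η') * (b - a) ≤
      (1 / η) * Real.log (∑ m ∈ s, p m * Real.exp (-η * φ m)) := by
  have hη' : 0 < η' := hη.trans_le h
  have hZ := weighted_sum_exp_pos (φ := φ) hp hsum η
  have hlow := (Real.le_log_iff_exp_le hZ).2 (exp_neg_mul_le_weighted_sum_exp hp hsum hη.le hb)
  have hup := Real.log_le_log (weighted_sum_exp_pos hp hsum η')
    (weighted_sum_exp_le_exp_mul hp h ha)
  rw [Real.log_mul (Real.exp_pos _).ne' hZ.ne', Real.log_exp] at hup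
  generalize Real.log (∑ m ∈ s, p m * Real.exp (-η * φ m)) = L at *
  generalize Real.log (∑ m ∈ s, p m * Real.exp (-η' * φ m)) = L' at *
  have hF : -b ≤ 1 / η * L := by
    rw [one_div_mul_eq_div, le_div_iff₀ hη]
    linarith
  have hr : 0 ≤ 1 - η / η' := sub_nonneg.2 ((div_le_one hη').2 h)
  calc 1 / η' * L' - (1 - η / η') * (b - a)
      ≤ 1 / η' * (-(η' - η) * a + L) - (1 - η / η') * (b - a) := by gcongr
    _ = 1 / η * L - (1 - η / η') * (1 / η * L - -b) := by
        field_simp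
        ring
    _ ≤ 1 / η * L := sub_le_self _ (mul_nonneg hr (sub_nonneg.2 hF))

end WeightedExponentialSums

/-- Lemma 2 of the paper: changing the learning rate in the log-moment term. -/
theorem stmt_1 (M : ℕ) [NeZero M] (hM : 1 ≤ M)
    (p φ : Fin M → ℝ)
    (hp0 : ∀ m, 0 ≤ p m) (hp1 : ∀ m, p m ≤ 1)
    (hpsum : ∑ m, p m = 1)
    (η η' : ℝ) (hη : 0 < η) (hη' : 0 < η') :
    (1 / η) * Real.log (∑ m, p m * Real.exp (-η * φ m)) ≥
      (1 / η') * Real.log (∑ m, p m * Real.exp (-η' * φ m)) -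
        |1 - η / η'| *
          (Finset.univ.sup' Finset.univ_nonempty φ -
            Finset.univ.inf' Finset.univ_nonempty φ) := by
  have ha (m) (hm : m ∈ Finset.univ) : Finset.univ.inf' Finset.univ_nonempty φ ≤ φ m :=
    Finset.inf'_le φ hm
  have hb (m) (hm : m ∈ Finset.univ) : φ m ≤ Finset.univ.sup' Finset.univ_nonempty φ :=
    Finset.le_sup' φ hm
  rcases le_total η η' with h | h
  · rw [abs_of_nonneg (sub_nonneg.2 ((div_le_one hη').2 h))]
    exact log_weighted_sum_exp_div_sub_le (fun m _ => hp0 m) hpsum hη h ha hb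
  · have hd := (ha 0 (Finset.mem_univ _)).trans (hb 0 (Finset.mem_univ _))
    exact (sub_le_self _ (mul_nonneg (abs_nonneg _) (sub_nonneg.2 hd))).trans
      (log_weighted_sum_exp_div_mono (fun m _ => hp0 m) hpsum hη' h)
end

section
/- Under the one-step algorithm setup below, (1/η₁)·log(∑_{m=1}^M p_m·exp(−η₁·φ_m)) ≥ (1/η₁)·log(∑_{λ'∈Ω'} z'_{λ'}) − (1/η₂)·log(∑_{λ∈Ω} z_λ) − (1/η₁ − 1/η₂)·log|Ω|. -/
/-- For `r ≥ 1`, the logarithm of a sum of `1 / r`-th powers is controlled by the logarithm of the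
sum and of the number of summands. -/
theorem mul_log_sum_rpow_inv_le {ι : Type*} [Fintype ι] [Nonempty ι] {z : ι → ℝ}
    (hz : ∀ i, 0 < z i) {r : ℝ} (hr : 1 ≤ r) :
    r * Real.log (∑ i, z i ^ r⁻¹) ≤
      (r - 1) * Real.log (Fintype.card ι) + Real.log (∑ i, z i) := by
  have hr0 : r ≠ 0 := by positivity
  have hZ : 0 < ∑ i, z i := Finset.sum_pos (fun i _ => hz i) Finset.univ_nonempty
  have hW : 0 < ∑ i, z i ^ r⁻¹ :=
    Finset.sum_pos (fun i _ => Real.rpow_pos_of_pos (hz i) _) Finset.univ_nonempty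
  have hn : (0 : ℝ) < Fintype.card ι := by exact_mod_cast Fintype.card_pos
  have h := Real.rpow_sum_le_const_mul_sum_rpow_of_nonneg (s := Finset.univ)
    (f := fun i => z i ^ r⁻¹) hr (fun i _ => (Real.rpow_pos_of_pos (hz i) _).le)
  simp only [Real.rpow_inv_rpow (hz _).le hr0, Finset.card_univ] at h
  have hlog := Real.log_le_log (Real.rpow_pos_of_pos hW r) h
  rwa [Real.log_rpow hW, Real.log_mul (Real.rpow_pos_of_pos hn _).ne' hZ.ne',
    Real.log_rpow hn] at hlog

/-- Lemma 4 of the paper: one-step lower bound on the log-moment term via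
consecutive log-partition-function differences. -/
theorem stmt_4 (M : ℕ) (hM : 1 ≤ M)
    (Ω Ω' : Type) [Fintype Ω] [Fintype Ω'] [Nonempty Ω] [Nonempty Ω']
    (lab : Ω → Fin M) (lab' : Ω' → Fin M)
    (η₁ η₂ : ℝ) (hη₁ : 0 < η₁) (hη₁₂ : η₁ ≤ η₂)
    (z : Ω → ℝ) (hz : ∀ a, 0 < z a)
    (Tr : Ω → Ω' → ℝ) (hTr0 : ∀ a b, 0 ≤ Tr a b)
    (hTr1 : ∀ a, ∑ b, Tr a b = 1)
    (φ : Fin M → ℝ)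
    (w' : Ω' → ℝ) (hw' : ∀ b, w' b = ∑ a, Tr a b * z a ^ (η₁ / η₂))
    (wm : Fin M → ℝ)
    (hwm : ∀ m, wm m = ∑ b ∈ Finset.univ.filter (fun b => lab' b = m), w' b)
    (p : Fin M → ℝ) (hp : ∀ m, p m = wm m / ∑ m', wm m')
    (z' : Ω' → ℝ) (hz' : ∀ b, z' b = w' b * Real.exp (-η₁ * φ (lab' b))) :
    (1 / η₁) * Real.log (∑ m, p m * Real.exp (-η₁ * φ m)) ≥
      (1 / η₁) * Real.log (∑ b, z' b) - (1 / η₂) * Real.log (∑ a, z a) -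
        (1 / η₁ - 1 / η₂) * Real.log (Fintype.card Ω) := by
  have hη₂ : 0 < η₂ := hη₁.trans_le hη₁₂
  have hWpos : 0 < ∑ a, z a ^ (η₁ / η₂) :=
    Finset.sum_pos (fun a _ => Real.rpow_pos_of_pos (hz a) _) Finset.univ_nonempty
  have hw'sum : ∑ b, w' b = ∑ a, z a ^ (η₁ / η₂) := by
    simp_rw [hw']
    rw [Finset.sum_comm]
    simp_rw [← Finset.sum_mul, hTr1, one_mul]
  have hwmsum : ∑ m, wm m = ∑ a, z a ^ (η₁ / η₂) := by
    simp_rw [hwm]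
    rw [Finset.sum_fiberwise, hw'sum]
  have hnum : ∑ m, wm m * Real.exp (-η₁ * φ m) = ∑ b, z' b := by
    rw [← Finset.sum_fiberwise Finset.univ lab' z']
    refine Finset.sum_congr rfl fun m _ => ?_
    rw [hwm, Finset.sum_mul]
    refine Finset.sum_congr rfl fun b hb => ?_
    rw [hz', (Finset.mem_filter.mp hb).2]
  have hw'nonneg : ∀ b, 0 ≤ w' b := fun b => by
    rw [hw']
    exact Finset.sum_nonneg fun a _ => mul_nonneg (hTr0 a b) (Real.rpow_nonneg (hz a).le _)
  have hz'pos : 0 < ∑ b, z' b := by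
    obtain ⟨b, -, hb⟩ := Finset.exists_lt_of_sum_lt (s := Finset.univ)
      (f := fun _ : Ω' => (0 : ℝ)) (g := w') (by simpa [hw'sum] using hWpos)
    refine Finset.sum_pos' (fun c _ => ?_) ⟨b, Finset.mem_univ b, ?_⟩
    · rw [hz']
      exact mul_nonneg (hw'nonneg c) (Real.exp_pos _).le
    · rw [hz']
      exact mul_pos hb (Real.exp_pos _)
  have hmoment : ∑ m, p m * Real.exp (-η₁ * φ m) =
      (∑ b, z' b) / ∑ a, z a ^ (η₁ / η₂) := by
    simp_rw [hp, hwmsum, div_mul_eq_mul_div]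
    rw [← Finset.sum_div, hnum]
  have hpow := mul_log_sum_rpow_inv_le hz ((one_le_div hη₁).mpr hη₁₂)
  rw [inv_div] at hpow
  rw [hmoment, Real.log_div hz'pos.ne' hWpos.ne']
  have hscaled := mul_le_mul_of_nonneg_left hpow (one_div_pos.mpr hη₂).le
  have hleft : ∀ x : ℝ, 1 / η₂ * (η₂ / η₁ * x) = 1 / η₁ * x := fun x => by
    field_simp
  have hright : ∀ x y : ℝ, 1 / η₂ * ((η₂ / η₁ - 1) * x + y) =
      (1 / η₁ - 1 / η₂) * x + 1 / η₂ * y := fun x y => by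
    field_simp
  rw [hleft, hright] at hscaled
  linarith
end

section
/- Under the multi-step algorithm setup below, for every comparator path Λ_T = (λ_1,…,λ_T) with λ_t ∈ Ω_t and Τ(λ_t|λ_{t−1}) > 0 for all t, one has (1/η_{T−1})·log(z_{λ_T}) ≥ ∑_{t=1}^T (1/η_{t−1})·log Τ(λ_t|λ_{t−1}) − ∑_{t=1}^T φ_{t,ℓ_t(λ_t)}. -/
/-- Lemma 5 of the paper: telescoping lower bound on the weight of any
comparator path, in the multi-step algorithm setup.  Natural subtraction gives
`η (1-2) = η 0`, which encodes the convention `η₋₁ = η₀`. -/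
theorem stmt_5 (M T : ℕ) (hM : 1 ≤ M) (hT : 1 ≤ T)
    {Λ : Type} (Ω : ℕ → Finset Λ)
    (hΩne : ∀ t, t ≤ T → (Ω t).Nonempty)
    (hΩ0 : (Ω 0).card = 1)
    (lab : ℕ → Λ → Fin M)
    (Tr : ℕ → Λ → Λ → ℝ)
    (hTr0 : ∀ t a b, 0 ≤ Tr t a b)
    (hTr1 : ∀ t, 1 ≤ t → t ≤ T → ∀ a ∈ Ω (t - 1), ∑ b ∈ Ω t, Tr t a b = 1)
    (η : ℕ → ℝ)
    (hηpos : ∀ t, t ≤ T → 0 < η t)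
    (hηdec : ∀ t, t < T → η (t + 1) ≤ η t)
    (φ : ℕ → Fin M → ℝ)
    (w z : ℕ → Λ → ℝ)
    (hw0 : ∀ a ∈ Ω 0, w 0 a = 1)
    (hz0 : ∀ a ∈ Ω 0, z 0 a = 1)
    (hw : ∀ t, 1 ≤ t → t ≤ T → ∀ a ∈ Ω t,
      w t a = ∑ b ∈ Ω (t - 1), Tr t b a * z (t - 1) b ^ (η (t - 1) / η (t - 2)))
    (hz : ∀ t, 1 ≤ t → t ≤ T → ∀ a ∈ Ω t,
      z t a = w t a * Real.exp (-η (t - 1) * φ t (lab t a)))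
    (lam : ℕ → Λ)
    (hlam : ∀ t, t ≤ T → lam t ∈ Ω t)
    (hlamTr : ∀ t, 1 ≤ t → t ≤ T → 0 < Tr t (lam (t - 1)) (lam t)) :
    (1 / η (T - 1)) * Real.log (z T (lam T)) ≥
      ∑ t ∈ Finset.Icc 1 T, (1 / η (t - 1)) * Real.log (Tr t (lam (t - 1)) (lam t)) -
        ∑ t ∈ Finset.Icc 1 T, φ t (lab t (lam t)) := by
  have z_nonneg : ∀ n, n ≤ T → ∀ a ∈ Ω n, 0 ≤ z n a := by
    intro n
    induction n with
    | zero => intro _ a ha; rw [hz0 a ha]; exact zero_le_one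
    | succ n ih =>
      intro hn a ha
      rw [hz (n + 1) (by omega) hn a ha, hw (n + 1) (by omega) hn a ha]
      exact mul_nonneg (Finset.sum_nonneg fun b hb => mul_nonneg (hTr0 _ _ _)
        (Real.rpow_nonneg (ih (by omega) b hb) _)) (Real.exp_pos _).le
  have path_bound : ∀ n, n ≤ T → 0 < z n (lam n) ∧
      ∑ t ∈ Finset.Icc 1 n, (1 / η (t - 1)) * Real.log (Tr t (lam (t - 1)) (lam t)) -
        ∑ t ∈ Finset.Icc 1 n, φ t (lab t (lam t)) ≤
      (1 / η (n - 1)) * Real.log (z n (lam n)) := by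
    intro n
    induction n with
    | zero => intro h; simp [hz0 _ (hlam 0 h)]
    | succ n ih =>
      intro hn
      obtain ⟨z_pos, bound_n⟩ := ih (by omega)
      have η_pos : 0 < η n := hηpos n (by omega)
      have Tr_pos : 0 < Tr (n + 1) (lam n) (lam (n + 1)) := hlamTr (n + 1) (by omega) hn
      have rpow_pos : 0 < z n (lam n) ^ (η n / η (n - 1)) := Real.rpow_pos_of_pos z_pos _
      have w_ge : Tr (n + 1) (lam n) (lam (n + 1)) * z n (lam n) ^ (η n / η (n - 1)) ≤
          w (n + 1) (lam (n + 1)) := by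
        rw [hw (n + 1) (by omega) hn _ (hlam _ hn)]
        exact Finset.single_le_sum
          (f := fun b => Tr (n + 1) b (lam (n + 1)) * z n b ^ (η n / η (n - 1)))
          (fun b hb => mul_nonneg (hTr0 _ _ _)
            (Real.rpow_nonneg (z_nonneg n (by omega) b hb) _)) (hlam n (by omega))
      have w_pos : 0 < w (n + 1) (lam (n + 1)) := (mul_pos Tr_pos rpow_pos).trans_le w_ge
      have log_w_ge := Real.log_le_log (mul_pos Tr_pos rpow_pos) w_ge
      rw [Real.log_mul Tr_pos.ne' rpow_pos.ne', Real.log_rpow z_pos] at log_w_ge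
      rw [hz (n + 1) (by omega) hn _ (hlam _ hn), Finset.sum_Icc_succ_top (by omega),
        Finset.sum_Icc_succ_top (by omega), Real.log_mul w_pos.ne' (Real.exp_pos _).ne',
        Real.log_exp]
      refine ⟨mul_pos w_pos (Real.exp_pos _), ?_⟩
      simp only [Nat.add_sub_cancel]
      have scaled := mul_le_mul_of_nonneg_left log_w_ge (one_div_pos.mpr η_pos).le
      have expand : 1 / η n * (Real.log (Tr (n + 1) (lam n) (lam (n + 1))) +
          η n / η (n - 1) * Real.log (z n (lam n))) =
          1 / η n * Real.log (Tr (n + 1) (lam n) (lam (n + 1))) +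
          1 / η (n - 1) * Real.log (z n (lam n)) := by
        field_simp
      have cancel : 1 / η n * (Real.log (w (n + 1) (lam (n + 1))) +
          -η n * φ (n + 1) (lab (n + 1) (lam (n + 1)))) =
          1 / η n * Real.log (w (n + 1) (lam (n + 1))) -
          φ (n + 1) (lab (n + 1) (lam (n + 1))) := by
        field_simp
        ring
      linarith
  exact (path_bound T le_rfl).2
end

section
/- Under the multi-step algorithm setup below, for every comparator path Λ_T = (λ_1,…,λ_T) with λ_t ∈ Ω_t and Τ(λ_t|λ_{t−1}) > 0 for all t, one has ∑_{t=1}^T (1/η_t)·log(∑_{m=1}^M p_{t,m}·exp(−η_t·φ_{t,m})) ≥ −∑_{t=1}^T φ_{t,ℓ_t(λ_t)} − ∑_{t=1}^T (1 − η_t/η_{t−1})·d_t + ∑_{t=1}^T (1/η_{t−1})·log Τ(λ_t|λ_{t−1}) − (1/η_{T−1})·log(max_{1≤t≤T} |Ω_{t−1}|), where d_t = max_m φ_{t,m} − min_m φ_{t,m}. -/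
open Finset in
/-- Lowering the learning rate from `a` to `b` decreases the normalized log-moment of a quantity
with values in `[c, d]` by at most `(1 - b / a) * (d - c)`. -/
theorem inv_mul_log_moment_sub_le {ι : Type*} (s : Finset ι) (p f : ι → ℝ) {a b c d : ℝ}
    (hp : ∀ i ∈ s, 0 ≤ p i) (hp1 : ∑ i ∈ s, p i = 1) (hb : 0 < b) (hba : b ≤ a)
    (hc : ∀ i ∈ s, c ≤ f i) (hd : ∀ i ∈ s, f i ≤ d) :
    1 / a * Real.log (∑ i ∈ s, p i * Real.exp (-a * f i)) - (1 - b / a) * (d - c) ≤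
      1 / b * Real.log (∑ i ∈ s, p i * Real.exp (-b * f i)) := by
  have ha : 0 < a := hb.trans_le hba
  have exp_le_moment {e : ℝ} (he : 0 < e) :
      Real.exp (-e * d) ≤ ∑ i ∈ s, p i * Real.exp (-e * f i) := by
    rw [← one_mul (Real.exp (-e * d)), ← hp1, sum_mul]
    refine sum_le_sum fun i hi => mul_le_mul_of_nonneg_left (Real.exp_le_exp.2 ?_) (hp i hi)
    nlinarith [hd i hi]
  have hA := (Real.exp_pos _).trans_le (exp_le_moment ha)
  have hB := (Real.exp_pos _).trans_le (exp_le_moment hb)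
  have hBd := (Real.le_log_iff_exp_le hB).2 (exp_le_moment hb)
  have hAB : Real.log (∑ i ∈ s, p i * Real.exp (-a * f i)) + (a - b) * c ≤
      Real.log (∑ i ∈ s, p i * Real.exp (-b * f i)) := by
    rw [← Real.log_exp ((a - b) * c), ← Real.log_mul hA.ne' (Real.exp_pos _).ne']
    refine Real.log_le_log (mul_pos hA (Real.exp_pos _)) ?_
    rw [sum_mul]
    refine sum_le_sum fun i hi => ?_
    rw [mul_assoc, ← Real.exp_add]
    refine mul_le_mul_of_nonneg_left (Real.exp_le_exp.2 ?_) (hp i hi)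
    nlinarith [mul_le_mul_of_nonneg_left (hc i hi) (sub_nonneg.2 hba)]
  generalize Real.log (∑ i ∈ s, p i * Real.exp (-a * f i)) = A at *
  generalize Real.log (∑ i ∈ s, p i * Real.exp (-b * f i)) = B at *
  have key : b * A - b * (a - b) * (d - c) ≤ a * B := by
    nlinarith [mul_le_mul_of_nonneg_left hAB hb.le,
      mul_le_mul_of_nonneg_left hBd (sub_nonneg.2 hba)]
  calc 1 / a * A - (1 - b / a) * (d - c)
      = (b * A - b * (a - b) * (d - c)) / (a * b) := by field_simp
    _ ≤ a * B / (a * b) := div_le_div_of_nonneg_right key (mul_pos ha hb).le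
    _ = 1 / b * B := by field_simp

open Finset in
/-- The power-mean inequality in logarithmic form, for exponents `b / a ≤ 1`. -/
theorem inv_mul_log_sum_rpow_le {ι : Type*} (s : Finset ι) (z : ι → ℝ) {a b N : ℝ}
    (hz : ∀ i ∈ s, 0 ≤ z i) {j : ι} (hj : j ∈ s) (hzj : 0 < z j) (hb : 0 < b) (hba : b ≤ a)
    (hN : (s.card : ℝ) ≤ N) :
    1 / b * Real.log (∑ i ∈ s, z i ^ (b / a)) ≤
      (1 / b - 1 / a) * Real.log N + 1 / a * Real.log (∑ i ∈ s, z i) := by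
  have ha : 0 < a := hb.trans_le hba
  have hcard : 0 < (s.card : ℝ) := by exact_mod_cast card_pos.2 ⟨j, hj⟩
  have hS : 0 < ∑ i ∈ s, z i ^ (b / a) :=
    sum_pos' (fun i hi => Real.rpow_nonneg (hz i hi) _) ⟨j, hj, Real.rpow_pos_of_pos hzj _⟩
  have hZ : 0 < ∑ i ∈ s, z i := sum_pos' hz ⟨j, hj, hzj⟩
  have h := Real.rpow_sum_le_const_mul_sum_rpow_of_nonneg (p := a / b) s
    ((one_le_div hb).2 hba) (f := fun i => z i ^ (b / a)) fun i hi => Real.rpow_nonneg (hz i hi) _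
  have hpow : ∑ i ∈ s, (z i ^ (b / a)) ^ (a / b) = ∑ i ∈ s, z i := by
    refine sum_congr rfl fun i hi => ?_
    rw [← Real.rpow_mul (hz i hi), div_mul_div_cancel₀ ha.ne', div_self hb.ne', Real.rpow_one]
  rw [hpow] at h
  have h' := Real.log_le_log (Real.rpow_pos_of_pos hS _) h
  rw [Real.log_rpow hS, Real.log_mul (Real.rpow_pos_of_pos hcard _).ne' hZ.ne',
    Real.log_rpow hcard] at h'
  have hlogN := Real.log_le_log hcard hN
  have hcoef : 0 ≤ a / b - 1 := sub_nonneg.2 ((one_le_div hb).2 hba)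
  calc 1 / b * Real.log (∑ i ∈ s, z i ^ (b / a))
      = a / b * Real.log (∑ i ∈ s, z i ^ (b / a)) / a := by field_simp
    _ ≤ ((a / b - 1) * Real.log N + Real.log (∑ i ∈ s, z i)) / a :=
      div_le_div_of_nonneg_right
        (h'.trans (add_le_add_left (mul_le_mul_of_nonneg_left hlogN hcoef) _)) ha.le
    _ = (1 / b - 1 / a) * Real.log N + 1 / a * Real.log (∑ i ∈ s, z i) := by field_simp


/-- Lemma 6 of the paper: lower bound on the sum of log-moment terms along the
rounds, against any comparator path, in the multi-step algorithm setup. -/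
theorem stmt_6 (M T : ℕ) [NeZero M] (hM : 1 ≤ M) (hT : 1 ≤ T)
    {Λ : Type} (Ω : ℕ → Finset Λ)
    (hΩne : ∀ t, t ≤ T → (Ω t).Nonempty)
    (hΩ0 : (Ω 0).card = 1)
    (lab : ℕ → Λ → Fin M)
    (Tr : ℕ → Λ → Λ → ℝ)
    (hTr0 : ∀ t a b, 0 ≤ Tr t a b)
    (hTr1 : ∀ t, 1 ≤ t → t ≤ T → ∀ a ∈ Ω (t - 1), ∑ b ∈ Ω t, Tr t a b = 1)
    (η : ℕ → ℝ)
    (hηpos : ∀ t, t ≤ T → 0 < η t)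
    (hηdec : ∀ t, t < T → η (t + 1) ≤ η t)
    (φ : ℕ → Fin M → ℝ)
    (w z : ℕ → Λ → ℝ)
    (hw0 : ∀ a ∈ Ω 0, w 0 a = 1)
    (hz0 : ∀ a ∈ Ω 0, z 0 a = 1)
    (hw : ∀ t, 1 ≤ t → t ≤ T → ∀ a ∈ Ω t,
      w t a = ∑ b ∈ Ω (t - 1), Tr t b a * z (t - 1) b ^ (η (t - 1) / η (t - 2)))
    (hz : ∀ t, 1 ≤ t → t ≤ T → ∀ a ∈ Ω t,
      z t a = w t a * Real.exp (-η (t - 1) * φ t (lab t a)))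
    (p : ℕ → Fin M → ℝ)
    (hp : ∀ t, 1 ≤ t → t ≤ T → ∀ m,
      p t m = (∑ a ∈ (Ω t).filter (fun a => lab t a = m), w t a) /
        ∑ m' : Fin M, ∑ a ∈ (Ω t).filter (fun a => lab t a = m'), w t a)
    (lam : ℕ → Λ)
    (hlam : ∀ t, t ≤ T → lam t ∈ Ω t)
    (hlamTr : ∀ t, 1 ≤ t → t ≤ T → 0 < Tr t (lam (t - 1)) (lam t)) :
    ∑ t ∈ Finset.Icc 1 T, (1 / η t) * Real.log (∑ m, p t m * Real.exp (-η t * φ t m)) ≥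
      -(∑ t ∈ Finset.Icc 1 T, φ t (lab t (lam t)))
      - (∑ t ∈ Finset.Icc 1 T, (1 - η t / η (t - 1)) *
          (Finset.univ.sup' Finset.univ_nonempty (φ t) -
            Finset.univ.inf' Finset.univ_nonempty (φ t)))
      + (∑ t ∈ Finset.Icc 1 T, (1 / η (t - 1)) * Real.log (Tr t (lam (t - 1)) (lam t)))
      - (1 / η (T - 1)) *
          Real.log (((Finset.Icc 1 T).sup fun t => (Ω (t - 1)).card : ℕ) : ℝ) := by
  have hηT {t : ℕ} (h1 : 1 ≤ t) (hT : t ≤ T) : η t ≤ η (t - 1) := by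
    have h := hηdec (t - 1) (by omega)
    rwa [Nat.sub_add_cancel h1] at h
  have hnonneg (t : ℕ) : t ≤ T → ∀ a ∈ Ω t, 0 ≤ w t a ∧ 0 ≤ z t a := by
    induction t with
    | zero => intro _ a ha; simp [hw0 a ha, hz0 a ha]
    | succ n ih =>
      intro hn a ha
      have hwa : 0 ≤ w (n + 1) a := by
        rw [hw (n + 1) (by omega) hn a ha]
        exact Finset.sum_nonneg fun b hb =>
          mul_nonneg (hTr0 _ _ _) (Real.rpow_nonneg (ih (by omega) b hb).2 _)
      refine ⟨hwa, ?_⟩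
      rw [hz (n + 1) (by omega) hn a ha]
      exact mul_nonneg hwa (Real.exp_pos _).le
  have hwlam (t : ℕ) (h1 : 1 ≤ t) (ht : t ≤ T) :
      Tr t (lam (t - 1)) (lam t) * z (t - 1) (lam (t - 1)) ^ (η (t - 1) / η (t - 2)) ≤
        w t (lam t) := by
    rw [hw t h1 ht _ (hlam t ht)]
    exact Finset.single_le_sum
      (f := fun b => Tr t b (lam t) * z (t - 1) b ^ (η (t - 1) / η (t - 2)))
      (fun b hb => mul_nonneg (hTr0 _ _ _)
        (Real.rpow_nonneg (hnonneg (t - 1) (by omega) b hb).2 _)) (hlam (t - 1) (by omega))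
  have hzpos (t : ℕ) : t ≤ T → 0 < z t (lam t) := by
    induction t with
    | zero => intro h; simp [hz0 _ (hlam 0 h)]
    | succ n ih =>
      intro hn
      rw [hz (n + 1) (by omega) hn _ (hlam _ hn)]
      exact mul_pos ((mul_pos (hlamTr _ (by omega) hn)
        (Real.rpow_pos_of_pos (ih (by omega)) _)).trans_le (hwlam _ (by omega) hn))
        (Real.exp_pos _)
  have hwpos (t : ℕ) (h1 : 1 ≤ t) (ht : t ≤ T) : 0 < w t (lam t) :=
    (mul_pos (hlamTr t h1 ht) (Real.rpow_pos_of_pos (hzpos (t - 1) (by omega)) _)).trans_le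
      (hwlam t h1 ht)
  have hWpos (t : ℕ) (h1 : 1 ≤ t) (ht : t ≤ T) : 0 < ∑ a ∈ Ω t, w t a :=
    Finset.sum_pos' (fun a ha => (hnonneg t ht a ha).1) ⟨_, hlam t ht, hwpos t h1 ht⟩
  have hZpos (t : ℕ) (ht : t ≤ T) : 0 < ∑ a ∈ Ω t, z t a :=
    Finset.sum_pos' (fun a ha => (hnonneg t ht a ha).2) ⟨_, hlam t ht, hzpos t ht⟩
  have hWsucc (t : ℕ) (h1 : 1 ≤ t) (ht : t ≤ T) :
      ∑ a ∈ Ω t, w t a = ∑ b ∈ Ω (t - 1), z (t - 1) b ^ (η (t - 1) / η (t - 2)) := by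
    rw [Finset.sum_congr rfl fun a ha => hw t h1 ht a ha, Finset.sum_comm]
    refine Finset.sum_congr rfl fun b hb => ?_
    rw [← Finset.sum_mul, hTr1 t h1 ht b hb, one_mul]
  have hp' (t : ℕ) (h1 : 1 ≤ t) (ht : t ≤ T) (m : Fin M) :
      p t m = (∑ a ∈ (Ω t).filter (fun a => lab t a = m), w t a) / ∑ a ∈ Ω t, w t a := by
    rw [hp t h1 ht m, Finset.sum_fiberwise]
  have hp0 (t : ℕ) (h1 : 1 ≤ t) (ht : t ≤ T) (m : Fin M) : 0 ≤ p t m := by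
    rw [hp' t h1 ht m]
    exact div_nonneg (Finset.sum_nonneg fun a ha =>
      (hnonneg t ht a (Finset.mem_filter.1 ha).1).1) (hWpos t h1 ht).le
  have hp1 (t : ℕ) (h1 : 1 ≤ t) (ht : t ≤ T) : ∑ m, p t m = 1 := by
    rw [Finset.sum_congr rfl fun m _ => hp' t h1 ht m, ← Finset.sum_div, Finset.sum_fiberwise,
      div_self (hWpos t h1 ht).ne']
  have hmoment (t : ℕ) (h1 : 1 ≤ t) (ht : t ≤ T) :
      ∑ m, p t m * Real.exp (-η (t - 1) * φ t m) =
        (∑ a ∈ Ω t, z t a) / ∑ a ∈ Ω t, w t a := by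
    rw [← Finset.sum_fiberwise (Ω t) (lab t) (z t), Finset.sum_div]
    refine Finset.sum_congr rfl fun m _ => ?_
    rw [hp' t h1 ht m, div_mul_eq_mul_div, Finset.sum_mul]
    congr 1
    refine Finset.sum_congr rfl fun a ha => ?_
    obtain ⟨ha', rfl⟩ := Finset.mem_filter.1 ha
    rw [hz t h1 ht a ha']
  set N : ℝ := (((Finset.Icc 1 T).sup fun t => (Ω (t - 1)).card : ℕ) : ℝ)
  have hcard (t : ℕ) (ht : t < T) : ((Ω t).card : ℝ) ≤ N := by
    have h := Finset.le_sup (f := fun t => (Ω (t - 1)).card)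
      (Finset.mem_Icc.2 ⟨Nat.le_add_left 1 t, ht⟩)
    exact Nat.cast_le.2 h
  have hlogN : 0 ≤ Real.log N := by
    refine Real.log_nonneg ?_
    have h := hcard 0 (by omega)
    rwa [hΩ0, Nat.cast_one] at h
  have hpotential (n : ℕ) : 1 ≤ n → n ≤ T →
      1 / η (n - 1) * Real.log (∑ a ∈ Ω n, z n a) - (1 / η (n - 1) - 1 / η 0) * Real.log N ≤
        ∑ t ∈ Finset.Icc 1 n,
          1 / η (t - 1) * Real.log ((∑ a ∈ Ω t, z t a) / ∑ a ∈ Ω t, w t a) := by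
    intro h1
    induction n, h1 using Nat.le_induction with
    | base =>
      intro _
      have hW : ∑ a ∈ Ω 1, w 1 a = 1 := by
        rw [hWsucc 1 le_rfl hT]
        simp only [Nat.sub_self]
        rw [Finset.sum_congr rfl fun b hb => by rw [hz0 b hb, Real.one_rpow]]
        simp [hΩ0]
      simp [hW]
    | succ n h1 ih =>
      intro hn
      rw [Finset.sum_Icc_succ_top (by omega), Real.log_div (hZpos _ hn).ne'
        (hWpos _ (by omega) hn).ne', hWsucc _ (by omega) hn]
      have hpow := inv_mul_log_sum_rpow_le (Ω n) (z n) (fun a ha => (hnonneg n (by omega) a ha).2)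
        (hlam n (by omega)) (hzpos n (by omega)) (hηpos n (by omega)) (hηT h1 (by omega))
        (hcard n hn)
      have := ih (by omega)
      rw [show n + 1 - 2 = n - 1 by omega, Nat.add_sub_cancel]
      linarith
  have hpath (n : ℕ) : n ≤ T →
      -(∑ t ∈ Finset.Icc 1 n, φ t (lab t (lam t))) +
        ∑ t ∈ Finset.Icc 1 n, 1 / η (t - 1) * Real.log (Tr t (lam (t - 1)) (lam t)) ≤
        1 / η (n - 1) * Real.log (z n (lam n)) := by
    induction n with
    | zero => intro h; simp [hz0 _ (hlam 0 h)]
    | succ n ih =>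
      intro hn
      have hη : 0 < η n := hηpos n (by omega)
      have hη' : 0 < η (n - 1) := hηpos (n - 1) (by omega)
      have hTrpos : 0 < Tr (n + 1) (lam n) (lam (n + 1)) := hlamTr (n + 1) (by omega) hn
      have hzn := hzpos n (by omega)
      have hlog := Real.log_le_log
        (mul_pos hTrpos (Real.rpow_pos_of_pos hzn _)) (hwlam (n + 1) (by omega) hn)
      rw [show n + 1 - 2 = n - 1 by omega, Nat.add_sub_cancel,
        Real.log_mul hTrpos.ne' (Real.rpow_pos_of_pos hzn _).ne', Real.log_rpow hzn] at hlog
      rw [Finset.sum_Icc_succ_top (by omega), Finset.sum_Icc_succ_top (by omega),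
        hz (n + 1) (by omega) hn _ (hlam _ hn),
        Real.log_mul (hwpos _ (by omega) hn).ne' (Real.exp_pos _).ne', Real.log_exp,
        Nat.add_sub_cancel]
      have hdiv := mul_le_mul_of_nonneg_left hlog (one_div_pos.2 hη).le
      have hcancel (x : ℝ) : 1 / η n * (η n / η (n - 1) * x) = 1 / η (n - 1) * x := by
        field_simp
      have hcancel' (x : ℝ) : 1 / η n * (-η n * x) = -x := by
        field_simp
      rw [mul_add, hcancel] at hdiv
      rw [mul_add, hcancel']
      have := ih (by omega)
      linarith
  have hrates : ∑ t ∈ Finset.Icc 1 T,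
      (1 / η (t - 1) * Real.log ((∑ a ∈ Ω t, z t a) / ∑ a ∈ Ω t, w t a) -
        (1 - η t / η (t - 1)) * (Finset.univ.sup' Finset.univ_nonempty (φ t) -
          Finset.univ.inf' Finset.univ_nonempty (φ t))) ≤
      ∑ t ∈ Finset.Icc 1 T, 1 / η t * Real.log (∑ m, p t m * Real.exp (-η t * φ t m)) := by
    refine Finset.sum_le_sum fun t ht => ?_
    obtain ⟨h1, ht⟩ := Finset.mem_Icc.1 ht
    rw [← hmoment t h1 ht]
    exact inv_mul_log_moment_sub_le _ _ _ (fun m _ => hp0 t h1 ht m) (hp1 t h1 ht)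
      (hηpos t ht) (hηT h1 ht) (fun m hm => Finset.inf'_le _ hm) fun m hm => Finset.le_sup' _ hm
  rw [Finset.sum_sub_distrib] at hrates
  have hend : 1 / η (T - 1) * Real.log (z T (lam T)) ≤
      1 / η (T - 1) * Real.log (∑ a ∈ Ω T, z T a) :=
    mul_le_mul_of_nonneg_left (Real.log_le_log (hzpos T le_rfl)
      (Finset.single_le_sum (fun a ha => (hnonneg T le_rfl a ha).2) (hlam T le_rfl)))
      (one_div_pos.2 (hηpos _ (by omega))).le
  have := mul_nonneg (one_div_pos.2 (hηpos 0 (by omega))).le hlogN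
  linarith [hpotential T hT le_rfl, hpath T le_rfl]
end

section
/- Under the multi-step algorithm setup below, assume additionally that −η_t·φ_{t,m} ≤ 1 for all t and m. Then for every comparator path Λ_T = (λ_1,…,λ_T) with λ_t ∈ Ω_t and Τ(λ_t|λ_{t−1}) > 0 for all t, one has ∑_{t=1}^T ( ∑_{m=1}^M p_{t,m}·φ_{t,m} − φ_{t,ℓ_t(λ_t)} ) ≤ ∑_{t=1}^T η_t·(∑_{m=1}^M p_{t,m}·φ_{t,m}²) + (1/η_{T−1})·log(max_{1≤t≤T} |Ω_{t−1}|) − (1/η_{T−1})·log Τ(Λ_T) + ∑_{t=1}^T (1 − η_t/η_{t−1})·d_t, where Τ(Λ_T) = ∏_{t=1}^T Τ(λ_t|λ_{t−1}) and d_t = max_m φ_{t,m} − min_m φ_{t,m}. -/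
/-- The exponential moment of a loss at rate `η`, bounded by first and second moments at a
smaller rate `η'` for which `exp x ≤ 1 + x + x ^ 2` applies, plus a range correction. -/
lemma log_sum_mul_exp_le {ι : Type*} (s : Finset ι) (w f : ι → ℝ) {η η' a b : ℝ}
    (hw : ∀ i ∈ s, 0 ≤ w i) (hW : 0 < ∑ i ∈ s, w i) (hη' : 0 < η') (hηη' : η' ≤ η)
    (hf : ∀ i ∈ s, -η' * f i ≤ 1) (ha : ∀ i ∈ s, a ≤ f i) (hb : ∀ i ∈ s, f i ≤ b) :
    (1 / η) * Real.log (∑ i ∈ s, w i * Real.exp (-η * f i)) ≤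
      (1 / η) * Real.log (∑ i ∈ s, w i) - (∑ i ∈ s, w i * f i) / (∑ i ∈ s, w i)
        + η' * ((∑ i ∈ s, w i * f i ^ 2) / (∑ i ∈ s, w i)) + (1 - η' / η) * (b - a) := by
  have hη : 0 < η := hη'.trans_le hηη'
  set W := ∑ i ∈ s, w i with hWdef
  set A := ∑ i ∈ s, w i * f i with hA
  set B := ∑ i ∈ s, w i * f i ^ 2 with hB
  have hE : ∑ i ∈ s, w i * Real.exp (-η * f i) ≤
      Real.exp (-(η - η') * a) * (W - η' * A + η' ^ 2 * B) := by
    rw [hWdef, hA, hB, Finset.mul_sum, Finset.mul_sum, ← Finset.sum_sub_distrib,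
      ← Finset.sum_add_distrib, Finset.mul_sum]
    refine Finset.sum_le_sum fun i hi => ?_
    have h1 : Real.exp (-η * f i) = Real.exp (-(η - η') * f i) * Real.exp (-η' * f i) := by
      rw [← Real.exp_add]; ring_nf
    have h2 : Real.exp (-(η - η') * f i) ≤ Real.exp (-(η - η') * a) :=
      Real.exp_le_exp.2 (by nlinarith [ha i hi])
    have h3 : Real.exp (-η' * f i) ≤ 1 + -η' * f i + (-η' * f i) ^ 2 := by
      rcases le_total (-1) (-η' * f i) with h | h
      · have := Real.abs_exp_sub_one_sub_id_le (abs_le.2 ⟨h, hf i hi⟩)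
        linarith [(abs_le.1 this).2]
      · have : Real.exp (-η' * f i) ≤ 1 := Real.exp_le_one_iff.2 (by linarith)
        nlinarith
    calc w i * Real.exp (-η * f i)
        ≤ w i * (Real.exp (-(η - η') * a) * (1 + -η' * f i + (-η' * f i) ^ 2)) := by
          rw [h1]
          exact mul_le_mul_of_nonneg_left
            (mul_le_mul h2 h3 (Real.exp_pos _).le (Real.exp_pos _).le) (hw i hi)
      _ = _ := by ring
  have hpos : 0 < ∑ i ∈ s, w i * Real.exp (-η * f i) := by
    obtain ⟨i, hi, hwi⟩ := Finset.exists_lt_of_sum_lt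
      (show ∑ i ∈ s, (0 : ℝ) < ∑ i ∈ s, w i by simpa using hW)
    exact Finset.sum_pos' (fun j hj => mul_nonneg (hw j hj) (Real.exp_pos _).le)
      ⟨i, hi, mul_pos hwi (Real.exp_pos _)⟩
  have hQ : 0 < W - η' * A + η' ^ 2 * B :=
    pos_of_mul_pos_right (hpos.trans_le hE) (Real.exp_pos _).le
  have hlogQ : Real.log (W - η' * A + η' ^ 2 * B) ≤
      Real.log W + (-η' * (A / W) + η' ^ 2 * (B / W)) := by
    have h := Real.log_le_sub_one_of_pos (div_pos hQ hW)
    rw [Real.log_div hQ.ne' hW.ne'] at h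
    have : (W - η' * A + η' ^ 2 * B) / W = 1 + (-η' * (A / W) + η' ^ 2 * (B / W)) := by
      field_simp
      ring
    linarith
  have hlog : Real.log (∑ i ∈ s, w i * Real.exp (-η * f i)) ≤
      -(η - η') * a + (Real.log W + (-η' * (A / W) + η' ^ 2 * (B / W))) := by
    have h := Real.log_le_log hpos hE
    rw [Real.log_mul (Real.exp_pos _).ne' hQ.ne', Real.log_exp] at h
    linarith
  have hAb : A / W ≤ b := by
    rw [div_le_iff₀ hW, hA, hWdef, Finset.mul_sum]
    exact Finset.sum_le_sum fun i hi => by nlinarith [hb i hi, hw i hi]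
  have hB0 : 0 ≤ B / W :=
    div_nonneg (Finset.sum_nonneg fun i hi => mul_nonneg (hw i hi) (sq_nonneg _)) hW.le
  have hstep := mul_le_mul_of_nonneg_left hlog (one_div_pos.2 hη).le
  have hr : 0 ≤ 1 - η' / η := sub_nonneg.2 ((div_le_one hη).2 hηη')
  have hexpand : (1 / η) * (-(η - η') * a + (Real.log W + (-η' * (A / W) + η' ^ 2 * (B / W)))) =
      (1 / η) * Real.log W - A / W + η' * (B / W) + (1 - η' / η) * (A / W - a)
        - (1 - η' / η) * (η' * (B / W)) := by
    field_simp
    ring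
  have h4 : (1 - η' / η) * (A / W - a) ≤ (1 - η' / η) * (b - a) :=
    mul_le_mul_of_nonneg_left (by linarith) hr
  have h5 : 0 ≤ (1 - η' / η) * (η' * (B / W)) := mul_nonneg hr (mul_nonneg hη'.le hB0)
  linarith

/-- The power-mean inequality for exponents `r ∈ [0, 1]`, in logarithmic form. -/
lemma log_sum_rpow_le {ι : Type*} (s : Finset ι) (z : ι → ℝ) {r : ℝ} (hr0 : 0 ≤ r)
    (hr1 : r ≤ 1) (hz : ∀ i ∈ s, 0 ≤ z i) (hZ : 0 < ∑ i ∈ s, z i) :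
    Real.log (∑ i ∈ s, z i ^ r) ≤
      (1 - r) * Real.log (s.card : ℝ) + r * Real.log (∑ i ∈ s, z i) := by
  have hs : s.Nonempty := Finset.nonempty_of_sum_ne_zero hZ.ne'
  have hc : (0 : ℝ) < s.card := by exact_mod_cast hs.card_pos
  have hJ := (Real.concaveOn_rpow hr0 hr1).le_map_sum (t := s) (w := fun _ => (s.card : ℝ)⁻¹)
    (p := z) (fun _ _ => by positivity) (by simp [hc.ne']) (fun i hi => hz i hi)
  simp only [smul_eq_mul, ← Finset.mul_sum] at hJ
  obtain ⟨i, hi, hzi⟩ := Finset.exists_lt_of_sum_lt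
    (show ∑ i ∈ s, (0 : ℝ) < ∑ i ∈ s, z i by simpa using hZ)
  have hpos : 0 < ∑ i ∈ s, z i ^ r :=
    Finset.sum_pos' (fun j hj => Real.rpow_nonneg (hz j hj) _) ⟨i, hi, Real.rpow_pos_of_pos hzi _⟩
  have h := Real.log_le_log (by positivity) hJ
  rw [Real.log_rpow (by positivity), Real.log_mul (by positivity) hpos.ne',
    Real.log_mul (by positivity) hZ.ne', Real.log_inv] at h
  linarith

/-- Averaging over labels with normalized label weights is averaging over the points. -/
lemma sum_label_weight_div_mul {ι κ : Type*} [Fintype κ] [DecidableEq κ] (s : Finset ι)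
    (l : ι → κ) (w : ι → ℝ) (g : κ → ℝ) :
    ∑ m, (∑ a ∈ s.filter (fun a => l a = m), w a) /
        (∑ m', ∑ a ∈ s.filter (fun a => l a = m'), w a) * g m =
      (∑ a ∈ s, w a * g (l a)) / ∑ a ∈ s, w a := by
  rw [Finset.sum_fiberwise, ← Finset.sum_fiberwise s l (fun a => w a * g (l a)),
    Finset.sum_div]
  refine Finset.sum_congr rfl fun m _ => ?_
  rw [div_mul_eq_mul_div, Finset.sum_mul]
  congr 1
  exact Finset.sum_congr rfl fun a ha => by rw [(Finset.mem_filter.1 ha).2]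


/-- Lemma 7 of the paper: the master regret bound with respect to the
algorithmic probabilities `p t m`, in the multi-step algorithm setup. -/
theorem stmt_7 (M T : ℕ) [NeZero M] (hM : 1 ≤ M) (hT : 1 ≤ T)
    {Λ : Type} (Ω : ℕ → Finset Λ)
    (hΩne : ∀ t, t ≤ T → (Ω t).Nonempty)
    (hΩ0 : (Ω 0).card = 1)
    (lab : ℕ → Λ → Fin M)
    (Tr : ℕ → Λ → Λ → ℝ)
    (hTr0 : ∀ t a b, 0 ≤ Tr t a b)
    (hTr1 : ∀ t, 1 ≤ t → t ≤ T → ∀ a ∈ Ω (t - 1), ∑ b ∈ Ω t, Tr t a b = 1)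
    (η : ℕ → ℝ)
    (hηpos : ∀ t, t ≤ T → 0 < η t)
    (hηdec : ∀ t, t < T → η (t + 1) ≤ η t)
    (φ : ℕ → Fin M → ℝ)
    (hφη : ∀ t, 1 ≤ t → t ≤ T → ∀ m, -η t * φ t m ≤ 1)
    (w z : ℕ → Λ → ℝ)
    (hw0 : ∀ a ∈ Ω 0, w 0 a = 1)
    (hz0 : ∀ a ∈ Ω 0, z 0 a = 1)
    (hw : ∀ t, 1 ≤ t → t ≤ T → ∀ a ∈ Ω t,
      w t a = ∑ b ∈ Ω (t - 1), Tr t b a * z (t - 1) b ^ (η (t - 1) / η (t - 2)))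
    (hz : ∀ t, 1 ≤ t → t ≤ T → ∀ a ∈ Ω t,
      z t a = w t a * Real.exp (-η (t - 1) * φ t (lab t a)))
    (p : ℕ → Fin M → ℝ)
    (hp : ∀ t, 1 ≤ t → t ≤ T → ∀ m,
      p t m = (∑ a ∈ (Ω t).filter (fun a => lab t a = m), w t a) /
        ∑ m' : Fin M, ∑ a ∈ (Ω t).filter (fun a => lab t a = m'), w t a)
    (lam : ℕ → Λ)
    (hlam : ∀ t, t ≤ T → lam t ∈ Ω t)
    (hlamTr : ∀ t, 1 ≤ t → t ≤ T → 0 < Tr t (lam (t - 1)) (lam t)) :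
    ∑ t ∈ Finset.Icc 1 T, ((∑ m, p t m * φ t m) - φ t (lab t (lam t))) ≤
      (∑ t ∈ Finset.Icc 1 T, η t * ∑ m, p t m * (φ t m) ^ 2)
      + (1 / η (T - 1)) *
          Real.log (((Finset.Icc 1 T).sup fun t => (Ω (t - 1)).card : ℕ) : ℝ)
      - (1 / η (T - 1)) *
          Real.log (∏ t ∈ Finset.Icc 1 T, Tr t (lam (t - 1)) (lam t))
      + ∑ t ∈ Finset.Icc 1 T, (1 - η t / η (t - 1)) *
          (Finset.univ.sup' Finset.univ_nonempty (φ t) -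
            Finset.univ.inf' Finset.univ_nonempty (φ t)) := by
  classical
  have hzn : ∀ n, n < T → ∀ a ∈ Ω (n + 1),
      z (n + 1) a = w (n + 1) a * Real.exp (-η n * φ (n + 1) (lab (n + 1) a)) :=
    fun n hn => by simpa using hz (n + 1) (by omega) hn
  have hTrn : ∀ n, n < T → ∀ a ∈ Ω n, ∑ b ∈ Ω (n + 1), Tr (n + 1) a b = 1 :=
    fun n hn => by simpa using hTr1 (n + 1) (by omega) hn
  have hwn : ∀ n, n < T → ∀ a ∈ Ω (n + 1),
      w (n + 1) a = ∑ b ∈ Ω n, Tr (n + 1) b a * z n b ^ (η n / η (n - 1)) :=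
    fun n hn => by simpa using hw (n + 1) (by omega) hn
  have hlamTrn : ∀ n, n < T → 0 < Tr (n + 1) (lam n) (lam (n + 1)) :=
    fun n hn => by simpa using hlamTr (n + 1) (by omega) hn
  have hz_nonneg : ∀ n, n ≤ T → ∀ a ∈ Ω n, 0 ≤ z n a := by
    intro n
    induction n with
    | zero => intro _ a ha; rw [hz0 a ha]; exact zero_le_one
    | succ n ih =>
      intro hn a ha
      rw [hzn n hn a ha, hwn n hn a ha]
      exact mul_nonneg (Finset.sum_nonneg fun b hb =>
        mul_nonneg (hTr0 _ _ _) (Real.rpow_nonneg (ih (by omega) b hb) _)) (Real.exp_pos _).le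
  have hw_nonneg : ∀ n, n < T → ∀ a ∈ Ω (n + 1), 0 ≤ w (n + 1) a := by
    intro n hn a ha
    rw [hwn n hn a ha]
    exact Finset.sum_nonneg fun b hb =>
      mul_nonneg (hTr0 _ _ _) (Real.rpow_nonneg (hz_nonneg n (by omega) b hb) _)
  have hw_path : ∀ n, n < T →
      Tr (n + 1) (lam n) (lam (n + 1)) * z n (lam n) ^ (η n / η (n - 1)) ≤
        w (n + 1) (lam (n + 1)) := by
    intro n hn
    rw [hwn n hn _ (hlam _ hn)]
    exact Finset.single_le_sum
      (f := fun b => Tr (n + 1) b (lam (n + 1)) * z n b ^ (η n / η (n - 1)))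
      (fun b hb => mul_nonneg (hTr0 _ _ _) (Real.rpow_nonneg (hz_nonneg n (by omega) b hb) _))
      (hlam n (by omega))
  have hz_path : ∀ n, n ≤ T → 0 < z n (lam n) := by
    intro n
    induction n with
    | zero => intro h; rw [hz0 _ (hlam 0 h)]; exact zero_lt_one
    | succ n ih =>
      intro hn
      rw [hzn n hn _ (hlam _ hn)]
      exact mul_pos ((mul_pos (hlamTrn n hn) (Real.rpow_pos_of_pos (ih (by omega)) _)).trans_le
        (hw_path n hn)) (Real.exp_pos _)
  have hw_path_pos : ∀ n, n < T → 0 < w (n + 1) (lam (n + 1)) := fun n hn =>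
    (mul_pos (hlamTrn n hn) (Real.rpow_pos_of_pos (hz_path n hn.le) _)).trans_le (hw_path n hn)
  have hTr_le : ∀ n, n < T → Tr (n + 1) (lam n) (lam (n + 1)) ≤ 1 := by
    intro n hn
    rw [← hTrn n hn (lam n) (hlam n hn.le)]
    exact Finset.single_le_sum (f := fun b => Tr (n + 1) (lam n) b) (fun b _ => hTr0 _ _ _)
      (hlam _ hn)
  have hlogTr : ∀ n, n < T → Real.log (Tr (n + 1) (lam n) (lam (n + 1))) ≤ 0 := fun n hn =>
    Real.log_nonpos (hTr0 _ _ _) (hTr_le n hn)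
  have hW : ∀ n, n < T → ∑ a ∈ Ω (n + 1), w (n + 1) a = ∑ b ∈ Ω n, z n b ^ (η n / η (n - 1)) := by
    intro n hn
    rw [Finset.sum_congr rfl (hwn n hn), Finset.sum_comm]
    refine Finset.sum_congr rfl fun b hb => ?_
    rw [← Finset.sum_mul, hTrn n hn b hb, one_mul]
  have hW_pos : ∀ n, n < T → 0 < ∑ a ∈ Ω (n + 1), w (n + 1) a := fun n hn =>
    Finset.sum_pos' (hw_nonneg n hn) ⟨_, hlam _ hn, hw_path_pos n hn⟩
  have hZ_pos : ∀ n, n ≤ T → 0 < ∑ a ∈ Ω n, z n a := fun n hn =>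
    Finset.sum_pos' (hz_nonneg n hn) ⟨_, hlam _ hn, hz_path n hn⟩
  have hinv : ∀ n, n < T → 1 / η n ≤ 1 / η (n + 1) := fun n hn =>
    one_div_le_one_div_of_le (hηpos _ hn) (hηdec n hn)
  have hlower : ∀ n, n < T →
      (1 / η n) * (∑ i ∈ Finset.range (n + 1), Real.log (Tr (i + 1) (lam i) (lam (i + 1))))
        - ∑ i ∈ Finset.range (n + 1), φ (i + 1) (lab (i + 1) (lam (i + 1))) ≤
      (1 / η n) * Real.log (z (n + 1) (lam (n + 1))) := by
    have hstep : ∀ n, n < T →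
        (1 / η n) * Real.log (Tr (n + 1) (lam n) (lam (n + 1))) +
          (1 / η (n - 1)) * Real.log (z n (lam n)) - φ (n + 1) (lab (n + 1) (lam (n + 1))) ≤
        (1 / η n) * Real.log (z (n + 1) (lam (n + 1))) := by
      intro n hn
      have hη := hηpos n hn.le
      have hη' := hηpos (n - 1) (by omega)
      have h := Real.log_le_log
        (mul_pos (hlamTrn n hn) (Real.rpow_pos_of_pos (hz_path n hn.le) _)) (hw_path n hn)
      rw [Real.log_mul (hlamTrn n hn).ne' (Real.rpow_pos_of_pos (hz_path n hn.le) _).ne',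
        Real.log_rpow (hz_path n hn.le)] at h
      rw [hzn n hn _ (hlam _ hn), Real.log_mul (hw_path_pos n hn).ne' (Real.exp_pos _).ne',
        Real.log_exp]
      have h' := mul_le_mul_of_nonneg_left h (one_div_pos.2 hη).le
      have e1 : (1 / η n) * (Real.log (Tr (n + 1) (lam n) (lam (n + 1))) +
          η n / η (n - 1) * Real.log (z n (lam n))) =
          (1 / η n) * Real.log (Tr (n + 1) (lam n) (lam (n + 1))) +
          (1 / η (n - 1)) * Real.log (z n (lam n)) := by
        field_simp
      have e2 : (1 / η n) * (Real.log (w (n + 1) (lam (n + 1))) +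
          -η n * φ (n + 1) (lab (n + 1) (lam (n + 1)))) =
          (1 / η n) * Real.log (w (n + 1) (lam (n + 1))) -
            φ (n + 1) (lab (n + 1) (lam (n + 1))) := by
        field_simp
        ring
      linarith
    intro n
    induction n with
    | zero =>
      intro hn
      have h := hstep 0 hn
      rw [hz0 _ (hlam 0 hn.le), Real.log_one] at h
      simpa using h
    | succ n ih =>
      intro hn
      have h1 := ih (by omega)
      have h2 := hstep (n + 1) hn
      rw [Nat.add_sub_cancel] at h2
      have h3 : ∑ i ∈ Finset.range (n + 1), Real.log (Tr (i + 1) (lam i) (lam (i + 1))) ≤ 0 :=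
        Finset.sum_nonpos fun i hi => hlogTr i (by have := Finset.mem_range.1 hi; omega)
      have h4 := mul_le_mul_of_nonpos_right (hinv n (by omega)) h3
      rw [Finset.sum_range_succ _ (n + 1), Finset.sum_range_succ _ (n + 1), mul_add]
      linarith
  set K : ℝ := (((Finset.Icc 1 T).sup fun t => (Ω (t - 1)).card : ℕ) : ℝ) with hK
  have hcard : ∀ n, n < T → ((Ω n).card : ℝ) ≤ K := by
    intro n hn
    have h := Finset.le_sup (f := fun t => (Ω (t - 1)).card)
      (Finset.mem_Icc.2 ⟨by omega, hn⟩ : n + 1 ∈ Finset.Icc 1 T)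
    rw [hK]
    exact_mod_cast h
  have hcard_pos : ∀ n, n ≤ T → (0 : ℝ) < (Ω n).card := fun n hn => by
    exact_mod_cast (hΩne n hn).card_pos
  have hK1 : 0 ≤ Real.log K :=
    Real.log_nonneg (by have := hcard 0 hT; rw [hΩ0] at this; simpa using this)
  have hstep : ∀ n, n < T →
      (1 / η n) * Real.log (∑ a ∈ Ω (n + 1), z (n + 1) a) ≤
      (1 / η n) * Real.log (∑ a ∈ Ω (n + 1), w (n + 1) a)
        - (∑ m, p (n + 1) m * φ (n + 1) m)
        + η (n + 1) * ∑ m, p (n + 1) m * (φ (n + 1) m) ^ 2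
        + (1 - η (n + 1) / η n) * (Finset.univ.sup' Finset.univ_nonempty (φ (n + 1)) -
            Finset.univ.inf' Finset.univ_nonempty (φ (n + 1))) := by
    intro n hn
    have hmom : ∀ g : Fin M → ℝ, ∑ m, p (n + 1) m * g m =
        (∑ a ∈ Ω (n + 1), w (n + 1) a * g (lab (n + 1) a)) / ∑ a ∈ Ω (n + 1), w (n + 1) a := by
      intro g
      rw [← sum_label_weight_div_mul (Ω (n + 1)) (lab (n + 1)) (w (n + 1)) g]
      exact Finset.sum_congr rfl fun m _ => by rw [hp (n + 1) (by omega) hn m]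
    rw [hmom (φ (n + 1)), hmom (fun m => φ (n + 1) m ^ 2), Finset.sum_congr rfl (hzn n hn)]
    exact log_sum_mul_exp_le (Ω (n + 1)) (w (n + 1)) (fun a => φ (n + 1) (lab (n + 1) a))
      (hw_nonneg n hn) (hW_pos n hn) (hηpos _ hn) (hηdec n hn)
      (fun a _ => hφη (n + 1) (by omega) hn _)
      (fun a _ => Finset.inf'_le _ (Finset.mem_univ _))
      (fun a _ => Finset.le_sup' _ (Finset.mem_univ _))
  have hupper : ∀ n, n < T →
      (1 / η n) * Real.log (∑ a ∈ Ω (n + 1), z (n + 1) a) ≤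
      ∑ i ∈ Finset.range (n + 1), (-(∑ m, p (i + 1) m * φ (i + 1) m)
        + η (i + 1) * ∑ m, p (i + 1) m * (φ (i + 1) m) ^ 2
        + (1 - η (i + 1) / η i) * (Finset.univ.sup' Finset.univ_nonempty (φ (i + 1)) -
            Finset.univ.inf' Finset.univ_nonempty (φ (i + 1))))
      + (1 / η n) * Real.log K := by
    intro n
    induction n with
    | zero =>
      intro hn
      have h := hstep 0 hn
      have hone : ∑ a ∈ Ω (0 + 1), w (0 + 1) a = 1 := by
        rw [hW 0 hn, Finset.sum_congr rfl fun b hb => by rw [hz0 b hb, Real.one_rpow]]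
        simp [hΩ0]
      rw [hone, Real.log_one] at h
      have h2 := mul_nonneg (one_div_pos.2 (hηpos 0 hn.le)).le hK1
      rw [Finset.sum_range_one]
      linarith
    | succ n ih =>
      intro hn
      have h1 := ih (by omega)
      have h2 := hstep (n + 1) hn
      have hη := hηpos n (by omega)
      have hη' := hηpos (n + 1) hn.le
      have hr1 : η (n + 1) / η n ≤ 1 := (div_le_one hη).2 (hηdec n (by omega))
      have h3 := log_sum_rpow_le (Ω (n + 1)) (z (n + 1)) (div_pos hη' hη).le hr1
        (hz_nonneg _ hn.le) (hZ_pos _ hn.le)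
      have hWn := hW (n + 1) hn
      rw [Nat.add_sub_cancel] at hWn
      rw [← hWn] at h3
      have h4 : (1 - η (n + 1) / η n) * Real.log ((Ω (n + 1)).card : ℝ) ≤
          (1 - η (n + 1) / η n) * Real.log K :=
        mul_le_mul_of_nonneg_left (Real.log_le_log (hcard_pos _ hn.le) (hcard _ hn))
          (sub_nonneg.2 hr1)
      have h5 := mul_le_mul_of_nonneg_left (h3.trans (add_le_add_left h4 _)) (one_div_pos.2 hη').le
      have e : (1 / η (n + 1)) * ((1 - η (n + 1) / η n) * Real.log K +
          η (n + 1) / η n * Real.log (∑ a ∈ Ω (n + 1), z (n + 1) a)) =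
          (1 / η (n + 1)) * Real.log K - (1 / η n) * Real.log K +
            (1 / η n) * Real.log (∑ a ∈ Ω (n + 1), z (n + 1) a) := by
        field_simp
      rw [Finset.sum_range_succ _ (n + 1)]
      linarith
  obtain ⟨N, rfl⟩ : ∃ N, T = N + 1 := ⟨T - 1, by omega⟩
  have hsum : ∀ g : ℕ → ℝ,
      ∑ t ∈ Finset.Icc 1 (N + 1), g t = ∑ i ∈ Finset.range (N + 1), g (i + 1) := fun g => by
    rw [← Finset.Ico_add_one_right_eq_Icc, Finset.sum_Ico_eq_sum_range]
    exact Finset.sum_congr (by simp) fun i _ => by rw [add_comm]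
  have hlogprod : Real.log (∏ t ∈ Finset.Icc 1 (N + 1), Tr t (lam (t - 1)) (lam t)) =
      ∑ i ∈ Finset.range (N + 1), Real.log (Tr (i + 1) (lam i) (lam (i + 1))) := by
    rw [Real.log_prod (fun t ht => (hlamTr t (Finset.mem_Icc.1 ht).1 (Finset.mem_Icc.1 ht).2).ne'),
      hsum]
    simp
  have hL := hlower N (by omega)
  have hU := hupper N (by omega)
  have hZ : (1 / η N) * Real.log (z (N + 1) (lam (N + 1))) ≤
      (1 / η N) * Real.log (∑ a ∈ Ω (N + 1), z (N + 1) a) :=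
    mul_le_mul_of_nonneg_left (Real.log_le_log (hz_path _ le_rfl)
      (Finset.single_le_sum (f := z (N + 1)) (hz_nonneg _ le_rfl) (hlam _ le_rfl)))
      (one_div_pos.2 (hηpos N (by omega))).le
  rw [hlogprod, hsum, hsum, hsum]
  simp only [Nat.add_sub_cancel, Finset.sum_add_distrib, Finset.sum_sub_distrib,
    Finset.sum_neg_distrib] at hU ⊢
  linarith
end

section
/- Consider the full-feedback algorithm below, run with φ_{t,m} = l_{t,m} − min_{m'} l_{t,m'} and learning rates η_t = min( √W/√V_t , W/D_t ) for t ≥ 1 (with η_0 = η_{−1} = η_1), where V_t = ∑_{t'=1}^t ∑_m p_{t',m}·φ_{t',m}² and D_t = max_{1≤t'≤t} (max_m φ_{t',m} − min_m φ_{t',m}) (terms of the min whose denominator is zero are omitted). Assume W ≥ 1, V_1 > 0 and D_1 > 0. Then for every comparator path Λ_T = (λ_1,…,λ_T) with Τ(λ_t|λ_{t−1}) > 0 and complexity W(Λ_T) = log(max_{1≤t≤T}|Ω_{t−1}|) − log(∏_{t=1}^T Τ(λ_t|λ_{t−1})) ≤ W, the regret satisfies ∑_{t=1}^T ( ∑_{m=1}^M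 p_{t,m}·l_{t,m} − l_{t,ℓ_t(λ_t)} ) ≤ 6·√( W·∑_{t=1}^T Δ_t² ), where Δ_t = max_m l_{t,m} − min_m l_{t,m}. -/
/-- Second-order upper bound for `exp (-x)` on the nonnegative half-line. -/
theorem Real.exp_neg_le_quadratic {x : ℝ} (hx : 0 ≤ x) :
    Real.exp (-x) ≤ 1 - x + x ^ 2 / 2 := by
  have h := Real.quadratic_le_exp_of_nonneg hx
  have hpos : 0 < 1 - x + x ^ 2 / 2 := by nlinarith [sq_nonneg (x - 1)]
  rw [Real.exp_neg, inv_le_comm₀ (Real.exp_pos x) hpos]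
  refine le_trans ?_ h
  rw [inv_le_iff_one_le_mul₀ hpos]
  nlinarith [sq_nonneg (x ^ 2)]

/-- Second-order bound for the exponential moment of a nonnegative loss, evaluated at a
rate `β` no larger than the rate `α` used in the moment. -/
theorem sum_mul_exp_neg_le {ι : Type*} [Fintype ι] {q f : ι → ℝ} {α β : ℝ}
    (hq : ∀ i, 0 ≤ q i) (hq1 : ∑ i, q i = 1) (hf : ∀ i, 0 ≤ f i)
    (hβ : 0 ≤ β) (hβα : β ≤ α) :
    ∑ i, q i * Real.exp (-α * f i) ≤
      Real.exp (-β * ∑ i, q i * f i + β ^ 2 / 2 * ∑ i, q i * f i ^ 2) := by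
  calc ∑ i, q i * Real.exp (-α * f i)
      ≤ ∑ i, q i * (1 - β * f i + (β * f i) ^ 2 / 2) := by
        refine Finset.sum_le_sum fun i _ => mul_le_mul_of_nonneg_left ?_ (hq i)
        refine le_trans (Real.exp_le_exp.mpr ?_)
          (Real.exp_neg_le_quadratic (mul_nonneg hβ (hf i)))
        nlinarith [hf i]
    _ = ∑ i, q i + (-β * ∑ i, q i * f i + β ^ 2 / 2 * ∑ i, q i * f i ^ 2) := by
        rw [Finset.mul_sum, Finset.mul_sum, ← Finset.sum_add_distrib, ← Finset.sum_add_distrib]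
        exact Finset.sum_congr rfl fun i _ => by ring
    _ ≤ _ := by
        rw [hq1, add_comm]
        exact Real.add_one_le_exp _

/-- Logarithmic form of the power-mean inequality for an exponent `β / α ≤ 1`. -/
theorem log_sum_rpow_div_le {ι : Type*} {s : Finset ι} {f : ι → ℝ} {α β : ℝ} {N : ℕ}
    (hf : ∀ i ∈ s, 0 ≤ f i) (hsum : 0 < ∑ i ∈ s, f i)
    (hpow : 0 < ∑ i ∈ s, f i ^ (β / α)) (hN : s.card ≤ N) (hs : s.Nonempty)
    (hβ : 0 < β) (hβα : β ≤ α) :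
    Real.log (∑ i ∈ s, f i ^ (β / α)) / β ≤
      (1 / β - 1 / α) * Real.log N + Real.log (∑ i ∈ s, f i) / α := by
  have hα : 0 < α := hβ.trans_le hβα
  have hp : 1 ≤ α / β := (one_le_div hβ).mpr hβα
  have hcard : (0 : ℝ) < s.card := by exact_mod_cast hs.card_pos
  have h := Real.rpow_sum_le_const_mul_sum_rpow s (fun i => f i ^ (β / α)) hp
  have h1 : ∑ i ∈ s, |f i ^ (β / α)| = ∑ i ∈ s, f i ^ (β / α) :=
    Finset.sum_congr rfl fun i hi => abs_of_nonneg (Real.rpow_nonneg (hf i hi) _)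
  have h2 : ∑ i ∈ s, |f i ^ (β / α)| ^ (α / β) = ∑ i ∈ s, f i := by
    refine Finset.sum_congr rfl fun i hi => ?_
    rw [abs_of_nonneg (Real.rpow_nonneg (hf i hi) _), ← Real.rpow_mul (hf i hi),
      div_mul_div_cancel₀ hα.ne', div_self hβ.ne', Real.rpow_one]
  rw [h1, h2] at h
  have hlog := Real.log_le_log (Real.rpow_pos_of_pos hpow _) h
  rw [Real.log_rpow hpow, Real.log_mul (Real.rpow_pos_of_pos hcard _).ne' hsum.ne',
    Real.log_rpow hcard] at hlog
  have hlogN : Real.log s.card ≤ Real.log N := Real.log_le_log hcard (by exact_mod_cast hN)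
  have hlog' : α / β * Real.log (∑ i ∈ s, f i ^ (β / α)) ≤
      (α / β - 1) * Real.log N + Real.log (∑ i ∈ s, f i) :=
    hlog.trans (by gcongr)
  calc Real.log (∑ i ∈ s, f i ^ (β / α)) / β
      = α / β * Real.log (∑ i ∈ s, f i ^ (β / α)) / α := by field_simp
    _ ≤ ((α / β - 1) * Real.log N + Real.log (∑ i ∈ s, f i)) / α :=
        div_le_div_of_nonneg_right hlog' hα.le
    _ = _ := by field_simp

/-- A self-normalised sum is at most twice the square root of the final total. -/
theorem sum_div_sqrt_le {T : ℕ} {v V : ℕ → ℝ} (hv : ∀ t ∈ Finset.Icc 1 T, 0 ≤ v t)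
    (hV : ∀ t ∈ Finset.Icc 1 T, V t = ∑ s ∈ Finset.Icc 1 t, v s) :
    ∑ t ∈ Finset.Icc 1 T, v t / Real.sqrt (V t) ≤
      2 * Real.sqrt (∑ t ∈ Finset.Icc 1 T, v t) := by
  induction T with
  | zero => simp
  | succ n ih =>
    have hsub : ∀ t ∈ Finset.Icc 1 n, t ∈ Finset.Icc 1 (n + 1) := fun t ht => by
      simp only [Finset.mem_Icc] at ht ⊢; omega
    have ih' := ih (fun t ht => hv t (hsub t ht)) (fun t ht => hV t (hsub t ht))
    have hlast := hV (n + 1) (by simp)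
    have hvl := hv (n + 1) (by simp)
    have hS : 0 ≤ ∑ t ∈ Finset.Icc 1 n, v t := Finset.sum_nonneg fun t ht => hv t (hsub t ht)
    rw [Finset.sum_Icc_succ_top (by omega)] at hlast
    rw [Finset.sum_Icc_succ_top (by omega), Finset.sum_Icc_succ_top (by omega), ← hlast]
    set S := ∑ t ∈ Finset.Icc 1 n, v t
    have hVn : 0 ≤ V (n + 1) := by linarith
    have hle : Real.sqrt S ≤ Real.sqrt (V (n + 1)) := Real.sqrt_le_sqrt (by linarith)
    have key : v (n + 1) / Real.sqrt (V (n + 1)) ≤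
        2 * (Real.sqrt (V (n + 1)) - Real.sqrt S) := by
      refine div_le_of_le_mul₀ (Real.sqrt_nonneg _) (by linarith) ?_
      nlinarith [Real.sq_sqrt hS, Real.sq_sqrt hVn, sq_nonneg (√(V (n + 1)) - √S)]
    linarith

/-- One round of exponential weights with rate `α`: the expected loss is controlled by the
decrease of the log-potential, up to second-order terms at the smaller next rate `β`. -/
theorem expected_loss_le {ι : Type*} [Fintype ι] {q f : ι → ℝ} {α β W : ℝ}
    (hq : ∀ i, 0 ≤ q i) (hq1 : ∑ i, q i = 1) (hf : ∀ i, 0 ≤ f i)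
    (hβ : 0 < β) (hβα : β ≤ α) (hW : ∀ i, f i ≤ W / β) :
    ∑ i, q i * f i ≤ -(Real.log (∑ i, q i * Real.exp (-α * f i)) / α) +
      W * (1 / β - 1 / α) + β * (∑ i, q i * f i ^ 2) / 2 := by
  have hα : 0 < α := hβ.trans_le hβα
  have hpos : 0 < ∑ i, q i * Real.exp (-α * f i) := by
    obtain ⟨i, -, hi⟩ := Finset.exists_lt_of_sum_lt (s := Finset.univ) (f := fun _ => (0 : ℝ))
      (g := q) (by simp [hq1])
    exact Finset.sum_pos' (fun j _ => mul_nonneg (hq j) (Real.exp_pos _).le)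
      ⟨i, Finset.mem_univ i, mul_pos hi (Real.exp_pos _)⟩
  have h := (Real.log_le_iff_le_exp hpos).mpr (sum_mul_exp_neg_le hq hq1 hf hβ.le hβα)
  have hmean : ∑ i, q i * f i ≤ W / β := by
    calc ∑ i, q i * f i ≤ ∑ i, q i * (W / β) :=
          Finset.sum_le_sum fun i _ => mul_le_mul_of_nonneg_left (hW i) (hq i)
      _ = W / β := by rw [← Finset.sum_mul, hq1, one_mul]
  have hv : 0 ≤ ∑ i, q i * f i ^ 2 :=
    Finset.sum_nonneg fun i _ => mul_nonneg (hq i) (sq_nonneg _)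
  set e := ∑ i, q i * f i
  set v := ∑ i, q i * f i ^ 2
  have h1 := div_le_div_of_nonneg_right h hα.le
  have hr : β / α ≤ 1 := (div_le_one hα).mpr hβα
  have h2 : (1 - β / α) * e ≤ (1 - β / α) * (W / β) :=
    mul_le_mul_of_nonneg_left hmean (by linarith)
  have h3 : (1 - β / α) * (W / β) = W * (1 / β - 1 / α) := by field_simp
  have h4 : (-β * e + β ^ 2 / 2 * v) / α = -(β / α) * e + β / α * (β * v / 2) := by
    field_simp
  have h5 : β / α * (β * v / 2) ≤ β * v / 2 := mul_le_of_le_one_left (by positivity) hr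
  linarith


/-- Theorem (thm:12) of the paper: full-feedback second-order data-dependent
regret bound with the parameter choice of Remark 3
(`φ_{t,m} = l_{t,m} − min_{m'} l_{t,m'}`, `η_t = min(√W/√V_t, W/D_t)`,
`ε_t = 0`). -/
theorem stmt_12 (M T : ℕ) [NeZero M] (hM : 1 ≤ M) (hT : 1 ≤ T)
    (l : ℕ → Fin M → ℝ)
    (W : ℝ) (hW : 1 ≤ W)
    {Λ : Type} (Ω : ℕ → Finset Λ)
    (hΩne : ∀ t, t ≤ T → (Ω t).Nonempty)
    (hΩ0 : (Ω 0).card = 1)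
    (lab : ℕ → Λ → Fin M)
    (Tr : ℕ → Λ → Λ → ℝ)
    (hTr0 : ∀ t a b, 0 ≤ Tr t a b)
    (hTr1 : ∀ t, 1 ≤ t → t ≤ T → ∀ a ∈ Ω (t - 1), ∑ b ∈ Ω t, Tr t a b = 1)
    (φ : ℕ → Fin M → ℝ) (η V D : ℕ → ℝ)
    (w z : ℕ → Λ → ℝ) (p : ℕ → Fin M → ℝ)
    (hp : ∀ t, 1 ≤ t → t ≤ T → ∀ m,
      p t m = (∑ a ∈ (Ω t).filter (fun a => lab t a = m), w t a) /
        ∑ m' : Fin M, ∑ a ∈ (Ω t).filter (fun a => lab t a = m'), w t a)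
    (hφ : ∀ t, 1 ≤ t → t ≤ T → ∀ m,
      φ t m = l t m - Finset.univ.inf' Finset.univ_nonempty (l t))
    (hV : ∀ t, 1 ≤ t → t ≤ T →
      V t = ∑ t' ∈ Finset.Icc 1 t, ∑ m, p t' m * (φ t' m) ^ 2)
    (hD : ∀ t, ∀ ht1 : 1 ≤ t, t ≤ T →
      D t = (Finset.Icc 1 t).sup' (Finset.nonempty_Icc.mpr ht1)
        (fun t' => Finset.univ.sup' Finset.univ_nonempty (φ t') -
          Finset.univ.inf' Finset.univ_nonempty (φ t')))
    (hη : ∀ t, 1 ≤ t → t ≤ T →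
      η t = min (Real.sqrt W / Real.sqrt (V t)) (W / D t))
    (hη0 : η 0 = η 1)
    (hV1 : 0 < V 1) (hD1 : 0 < D 1)
    (hw0 : ∀ a ∈ Ω 0, w 0 a = 1)
    (hz0 : ∀ a ∈ Ω 0, z 0 a = 1)
    (hw : ∀ t, 1 ≤ t → t ≤ T → ∀ a ∈ Ω t,
      w t a = ∑ b ∈ Ω (t - 1), Tr t b a * z (t - 1) b ^ (η (t - 1) / η (t - 2)))
    (hz : ∀ t, 1 ≤ t → t ≤ T → ∀ a ∈ Ω t,
      z t a = w t a * Real.exp (-η (t - 1) * φ t (lab t a)))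
    (lam : ℕ → Λ)
    (hlam : ∀ t, t ≤ T → lam t ∈ Ω t)
    (hlamTr : ∀ t, 1 ≤ t → t ≤ T → 0 < Tr t (lam (t - 1)) (lam t))
    (hcomp : Real.log (((Finset.Icc 1 T).sup fun t => (Ω (t - 1)).card : ℕ) : ℝ)
      - Real.log (∏ t ∈ Finset.Icc 1 T, Tr t (lam (t - 1)) (lam t)) ≤ W) :
    ∑ t ∈ Finset.Icc 1 T, ((∑ m, p t m * l t m) - l t (lab t (lam t))) ≤
      6 * Real.sqrt (W * ∑ t ∈ Finset.Icc 1 T,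
        (Finset.univ.sup' Finset.univ_nonempty (l t) -
          Finset.univ.inf' Finset.univ_nonempty (l t)) ^ 2) := by
  have hw_nonneg : ∀ t, t ≤ T → (∀ a ∈ Ω t, 0 ≤ w t a) ∧ ∀ a ∈ Ω t, 0 ≤ z t a := by
    intro t
    induction t with
    | zero => exact fun _ => ⟨fun a ha => by simp [hw0 a ha], fun a ha => by simp [hz0 a ha]⟩
    | succ n ih =>
      intro hn
      have hwn : ∀ a ∈ Ω (n + 1), 0 ≤ w (n + 1) a := fun a ha => by
        rw [hw (n + 1) (by omega) hn a ha]
        exact Finset.sum_nonneg fun b hb =>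
          mul_nonneg (hTr0 _ _ _) (Real.rpow_nonneg ((ih (by omega)).2 b hb) _)
      refine ⟨hwn, fun a ha => ?_⟩
      rw [hz (n + 1) (by omega) hn a ha]
      exact mul_nonneg (hwn a ha) (Real.exp_pos _).le
  have hz_nonneg : ∀ t, t ≤ T → ∀ a ∈ Ω t, 0 ≤ z t a := fun t ht => (hw_nonneg t ht).2
  replace hw_nonneg : ∀ t, t ≤ T → ∀ a ∈ Ω t, 0 ≤ w t a := fun t ht => (hw_nonneg t ht).1
  have hw_step : ∀ t, t + 1 ≤ T → ∀ a ∈ Ω (t + 1),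
      w (t + 1) a = ∑ b ∈ Ω t, Tr (t + 1) b a * z t b ^ (η t / η (t - 1)) :=
    fun t ht a ha => hw (t + 1) (by omega) ht a ha
  have hz_step : ∀ t, t + 1 ≤ T → ∀ a ∈ Ω (t + 1),
      z (t + 1) a = w (t + 1) a * Real.exp (-η t * φ (t + 1) (lab (t + 1) a)) :=
    fun t ht a ha => hz (t + 1) (by omega) ht a ha
  have hlam_le : ∀ t, t + 1 ≤ T →
      Tr (t + 1) (lam t) (lam (t + 1)) * z t (lam t) ^ (η t / η (t - 1)) ≤
        w (t + 1) (lam (t + 1)) := by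
    intro t ht
    rw [hw_step t ht _ (hlam _ ht)]
    exact Finset.single_le_sum
      (f := fun b => Tr (t + 1) b (lam (t + 1)) * z t b ^ (η t / η (t - 1)))
      (fun b hb => mul_nonneg (hTr0 _ _ _)
        (Real.rpow_nonneg (hz_nonneg t (by omega) b hb) _)) (hlam t (by omega))
  have hTr_pos : ∀ t, t + 1 ≤ T → 0 < Tr (t + 1) (lam t) (lam (t + 1)) :=
    fun t ht => hlamTr (t + 1) (by omega) ht
  have hz_lam : ∀ t, t ≤ T → 0 < z t (lam t) := by
    intro t
    induction t with
    | zero => exact fun h => by simp [hz0 _ (hlam 0 h)]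
    | succ n ih =>
      intro hn
      rw [hz_step n hn _ (hlam _ hn)]
      exact mul_pos ((mul_pos (hTr_pos n hn) (Real.rpow_pos_of_pos (ih (by omega)) _)).trans_le
        (hlam_le n hn)) (Real.exp_pos _)
  have hZ_pos : ∀ t, t ≤ T → 0 < ∑ a ∈ Ω t, z t a := fun t ht =>
    Finset.sum_pos' (hz_nonneg t ht) ⟨lam t, hlam t ht, hz_lam t ht⟩
  have hpow_pos : ∀ t, t ≤ T → 0 < ∑ a ∈ Ω t, z t a ^ (η t / η (t - 1)) := fun t ht =>
    Finset.sum_pos' (fun a ha => Real.rpow_nonneg (hz_nonneg t ht a ha) _)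
      ⟨lam t, hlam t ht, Real.rpow_pos_of_pos (hz_lam t ht) _⟩
  have hw_sum : ∀ t, t + 1 ≤ T →
      ∑ a ∈ Ω (t + 1), w (t + 1) a = ∑ b ∈ Ω t, z t b ^ (η t / η (t - 1)) := by
    intro t ht
    rw [Finset.sum_congr rfl (hw_step t ht), Finset.sum_comm]
    refine Finset.sum_congr rfl fun b hb => ?_
    rw [← Finset.sum_mul, hTr1 (t + 1) (by omega) ht b hb, one_mul]
  have hp_eq : ∀ t, t + 1 ≤ T → ∀ m, p (t + 1) m =
      (∑ a ∈ (Ω (t + 1)).filter (fun a => lab (t + 1) a = m), w (t + 1) a) /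
        ∑ a ∈ Ω (t + 1), w (t + 1) a := by
    intro t ht m
    rw [hp (t + 1) (by omega) ht m, Finset.sum_fiberwise]
  have hw_sum_pos : ∀ t, t + 1 ≤ T → 0 < ∑ a ∈ Ω (t + 1), w (t + 1) a :=
    fun t ht => hw_sum t ht ▸ hpow_pos t (by omega)
  have hp_nonneg : ∀ t, t + 1 ≤ T → ∀ m, 0 ≤ p (t + 1) m := fun t ht m => by
    rw [hp_eq t ht m]
    exact div_nonneg (Finset.sum_nonneg fun a ha =>
      hw_nonneg _ ht a (Finset.mem_filter.mp ha).1) (hw_sum_pos t ht).le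
  have hp_sum : ∀ t, t + 1 ≤ T → ∑ m, p (t + 1) m = 1 := fun t ht => by
    rw [Finset.sum_congr rfl fun m _ => hp_eq t ht m, ← Finset.sum_div, Finset.sum_fiberwise,
      div_self (hw_sum_pos t ht).ne']
  have hZ_eq : ∀ t, t + 1 ≤ T → ∑ a ∈ Ω (t + 1), z (t + 1) a =
      (∑ a ∈ Ω (t + 1), w (t + 1) a) *
        ∑ m, p (t + 1) m * Real.exp (-η t * φ (t + 1) m) := by
    intro t ht
    rw [Finset.sum_congr rfl (hz_step t ht), Finset.mul_sum,
      ← Finset.sum_fiberwise (Ω (t + 1)) (lab (t + 1))]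
    refine Finset.sum_congr rfl fun m _ => ?_
    rw [hp_eq t ht m, ← mul_assoc, mul_div_cancel₀ _ (hw_sum_pos t ht).ne', Finset.sum_mul]
    exact Finset.sum_congr rfl fun a ha => by rw [(Finset.mem_filter.mp ha).2]
  -- the shifted losses and their ranges
  set Δ : ℕ → ℝ := fun t => Finset.univ.sup' Finset.univ_nonempty (l t) -
    Finset.univ.inf' Finset.univ_nonempty (l t) with hΔ
  have hφ_nonneg : ∀ t, t + 1 ≤ T → ∀ m, 0 ≤ φ (t + 1) m := fun t ht m => by
    rw [hφ (t + 1) (by omega) ht m]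
    exact sub_nonneg.mpr (Finset.inf'_le _ (Finset.mem_univ m))
  have hφ_le : ∀ t, t + 1 ≤ T → ∀ m, φ (t + 1) m ≤ Δ (t + 1) := fun t ht m => by
    rw [hφ (t + 1) (by omega) ht m]
    exact sub_le_sub_right (Finset.le_sup' _ (Finset.mem_univ m)) _
  have hrange : ∀ t, t + 1 ≤ T → Finset.univ.sup' Finset.univ_nonempty (φ (t + 1)) -
      Finset.univ.inf' Finset.univ_nonempty (φ (t + 1)) = Δ (t + 1) := by
    intro t ht
    obtain ⟨i, -, hi⟩ := Finset.exists_mem_eq_sup' Finset.univ_nonempty (l (t + 1))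
    obtain ⟨j, -, hj⟩ := Finset.exists_mem_eq_inf' Finset.univ_nonempty (l (t + 1))
    have h1 : Finset.univ.sup' Finset.univ_nonempty (φ (t + 1)) = Δ (t + 1) := by
      refine le_antisymm (Finset.sup'_le _ _ fun m _ => hφ_le t ht m) ?_
      refine le_trans ?_ (Finset.le_sup' _ (Finset.mem_univ i))
      rw [hφ (t + 1) (by omega) ht i, hΔ]
      simp only [hi, le_refl]
    have h2 : Finset.univ.inf' Finset.univ_nonempty (φ (t + 1)) = 0 := by
      refine le_antisymm ?_ (Finset.le_inf' _ _ fun m _ => hφ_nonneg t ht m)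
      refine (Finset.inf'_le _ (Finset.mem_univ j)).trans ?_
      rw [hφ (t + 1) (by omega) ht j, hj, sub_self]
    rw [h1, h2, sub_zero]
  -- monotonicity of the learning rates
  set v : ℕ → ℝ := fun t => ∑ m, p t m * (φ t m) ^ 2 with hv
  have hv_nonneg : ∀ t, t + 1 ≤ T → 0 ≤ v (t + 1) := fun t ht =>
    Finset.sum_nonneg fun m _ => mul_nonneg (hp_nonneg t ht m) (sq_nonneg _)
  have hv_le : ∀ t, t + 1 ≤ T → v (t + 1) ≤ Δ (t + 1) ^ 2 := fun t ht => by
    calc v (t + 1) ≤ ∑ m, p (t + 1) m * Δ (t + 1) ^ 2 :=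
          Finset.sum_le_sum fun m _ => mul_le_mul_of_nonneg_left
            (pow_le_pow_left₀ (hφ_nonneg t ht m) (hφ_le t ht m) 2) (hp_nonneg t ht m)
      _ = Δ (t + 1) ^ 2 := by rw [← Finset.sum_mul, hp_sum t ht, one_mul]
  have hV_step : ∀ t, 1 ≤ t → t + 1 ≤ T → V t ≤ V (t + 1) := fun t h1 ht => by
    rw [hV (t + 1) (by omega) ht, hV t h1 (by omega), Finset.sum_Icc_succ_top (by omega)]
    exact le_add_of_nonneg_right (hv_nonneg t ht)
  have hD_step : ∀ t, 1 ≤ t → t + 1 ≤ T → D t ≤ D (t + 1) := fun t h1 ht => by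
    rw [hD (t + 1) (by omega) ht, hD t h1 (by omega)]
    exact Finset.sup'_mono _ (Finset.Icc_subset_Icc_right (by omega)) _
  have hV_pos : ∀ t, t + 1 ≤ T → 0 < V (t + 1) := fun t ht => by
    induction t with
    | zero => exact hV1
    | succ n ih => exact (ih (by omega)).trans_le (hV_step _ (by omega) ht)
  have hD_pos : ∀ t, t + 1 ≤ T → 0 < D (t + 1) := fun t ht => by
    induction t with
    | zero => exact hD1
    | succ n ih => exact (ih (by omega)).trans_le (hD_step _ (by omega) ht)
  have hW0 : 0 < W := by linarith
  have hη_pos_succ : ∀ t, t + 1 ≤ T → 0 < η (t + 1) := fun t ht => by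
    rw [hη (t + 1) (by omega) ht]
    exact lt_min (div_pos (Real.sqrt_pos.mpr hW0) (Real.sqrt_pos.mpr (hV_pos t ht)))
      (div_pos hW0 (hD_pos t ht))
  have hη_pos : ∀ t, t ≤ T → 0 < η t := by
    rintro (_ | t) ht
    · rw [hη0]; exact hη_pos_succ 0 hT
    · exact hη_pos_succ t ht
  have hη_step : ∀ t, t + 1 ≤ T → η (t + 1) ≤ η t := by
    rintro (_ | t) ht
    · rw [hη0]
    · rw [hη (t + 2) (by omega) ht, hη (t + 1) (by omega) (by omega)]
      have hVp := Real.sqrt_pos.mpr (hV_pos t (by omega))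
      have hDp := hD_pos t (by omega)
      have hVs := Real.sqrt_le_sqrt (hV_step (t + 1) (by omega) ht)
      have hDs := hD_step (t + 1) (by omega) ht
      exact min_le_min (div_le_div_of_nonneg_left (Real.sqrt_nonneg _) hVp hVs)
        (div_le_div_of_nonneg_left hW0.le hDp hDs)
  have hη_pred : ∀ t, t ≤ T → η t ≤ η (t - 1) := by
    rintro (_ | t) ht
    · exact le_rfl
    · exact hη_step t ht
  have hφ_rate : ∀ t, t + 1 ≤ T → ∀ m, φ (t + 1) m ≤ W / η (t + 1) := fun t ht m => by
    have hΔD : Δ (t + 1) ≤ D (t + 1) := by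
      rw [hD (t + 1) (by omega) ht, ← hrange t ht]
      exact Finset.le_sup' (fun t' => Finset.univ.sup' Finset.univ_nonempty (φ t') -
          Finset.univ.inf' Finset.univ_nonempty (φ t')) (Finset.mem_Icc.mpr ⟨by omega, le_rfl⟩)
    refine (hφ_le t ht m).trans (hΔD.trans ?_)
    rw [le_div_comm₀ (hD_pos t ht) (hη_pos_succ t ht), hη (t + 1) (by omega) ht]
    exact min_le_right _ _
  -- upper bound through the log-potential
  set N : ℕ := (Finset.Icc 1 T).sup fun t => (Ω (t - 1)).card with hN
  have hN_le : ∀ t, t + 1 ≤ T → (Ω t).card ≤ N := fun t ht =>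
    Finset.le_sup (f := fun t => (Ω (t - 1)).card) (b := t + 1)
      (Finset.mem_Icc.mpr ⟨by omega, ht⟩)
  have hN_log : 0 ≤ Real.log N := Real.log_natCast_nonneg N
  have hupper : ∀ t, t ≤ T → ∑ s ∈ Finset.Icc 1 t, ∑ m, p s m * φ s m ≤
      -(Real.log (∑ a ∈ Ω t, z t a) / η (t - 1)) + (1 / η (t - 1) - 1 / η 0) * Real.log N +
        W * (1 / η t - 1 / η 0) + (∑ s ∈ Finset.Icc 1 t, η s * v s) / 2 := by
    intro t
    induction t with
    | zero =>
      intro h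
      simp [Finset.sum_congr rfl hz0, hΩ0]
    | succ n ih =>
      intro hn
      have ih' := ih (by omega)
      have hround := expected_loss_le (hp_nonneg n hn) (hp_sum n hn) (hφ_nonneg n hn)
        (hη_pos _ hn) (hη_step n hn) (hφ_rate n hn)
      have hmix := log_sum_rpow_div_le (hz_nonneg n (by omega)) (hZ_pos n (by omega))
        (hpow_pos n (by omega)) (hN_le n hn) (hΩne n (by omega)) (hη_pos n (by omega))
        (hη_pred n (by omega))
      have hE : (∑ m, p (n + 1) m * Real.exp (-η n * φ (n + 1) m)) ≠ 0 := fun h0 => by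
        have := hZ_pos (n + 1) hn
        rw [hZ_eq n hn, h0, mul_zero] at this
        exact this.false
      have hlogZ : Real.log (∑ a ∈ Ω (n + 1), z (n + 1) a) / η n =
          Real.log (∑ a ∈ Ω n, z n a ^ (η n / η (n - 1))) / η n +
            Real.log (∑ m, p (n + 1) m * Real.exp (-η n * φ (n + 1) m)) / η n := by
        rw [hZ_eq n hn, Real.log_mul (hw_sum_pos n hn).ne' hE, hw_sum n hn, add_div]
      rw [Finset.sum_Icc_succ_top (by omega), Finset.sum_Icc_succ_top (by omega),
        Nat.add_sub_cancel, hlogZ]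
      change _ ≤ _ + _ + η (n + 1) * v (n + 1) / 2 at hround
      linarith
  -- lower bound along the comparator path
  have hTr_log : ∀ t, t + 1 ≤ T → Real.log (Tr (t + 1) (lam t) (lam (t + 1))) ≤ 0 := by
    intro t ht
    refine Real.log_nonpos (hTr0 _ _ _) ?_
    rw [← hTr1 (t + 1) (by omega) ht (lam t) (hlam t (by omega))]
    exact Finset.single_le_sum (f := fun b => Tr (t + 1) (lam t) b)
      (fun b _ => hTr0 _ _ _) (hlam _ ht)
  have hTr_sum : ∀ t, t ≤ T →
      ∑ s ∈ Finset.Icc 1 t, Real.log (Tr s (lam (s - 1)) (lam s)) ≤ 0 := fun t ht =>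
    Finset.sum_nonpos fun s hs => by
      obtain ⟨h1, h2⟩ := Finset.mem_Icc.mp hs
      obtain ⟨k, rfl⟩ := Nat.exists_eq_add_of_le' h1
      exact hTr_log k (by omega)
  have hlower : ∀ t, t ≤ T →
      (∑ s ∈ Finset.Icc 1 t, Real.log (Tr s (lam (s - 1)) (lam s))) / η (t - 1) -
        ∑ s ∈ Finset.Icc 1 t, φ s (lab s (lam s)) ≤ Real.log (z t (lam t)) / η (t - 1) := by
    intro t
    induction t with
    | zero => exact fun h => by simp [hz0 _ (hlam 0 h)]
    | succ n ih =>
      intro hn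
      have ih' := ih (by omega)
      have hzn := hz_lam n (by omega)
      have hηn := hη_pos n (by omega)
      have hlog := Real.log_le_log
        (mul_pos (hTr_pos n hn) (Real.rpow_pos_of_pos hzn _)) (hlam_le n hn)
      rw [Real.log_mul (hTr_pos n hn).ne' (Real.rpow_pos_of_pos hzn _).ne',
        Real.log_rpow hzn] at hlog
      have hwpos : 0 < w (n + 1) (lam (n + 1)) :=
        (mul_pos (hTr_pos n hn) (Real.rpow_pos_of_pos hzn _)).trans_le (hlam_le n hn)
      have hdiv := div_le_div_of_nonneg_right hlog hηn.le
      have hcancel : (Real.log (Tr (n + 1) (lam n) (lam (n + 1))) +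
          η n / η (n - 1) * Real.log (z n (lam n))) / η n =
          Real.log (Tr (n + 1) (lam n) (lam (n + 1))) / η n +
            Real.log (z n (lam n)) / η (n - 1) := by
        have := (hηn.trans_le (hη_pred n (by omega))).ne'
        field_simp
      have hrate : (∑ s ∈ Finset.Icc 1 n, Real.log (Tr s (lam (s - 1)) (lam s))) / η n ≤
          (∑ s ∈ Finset.Icc 1 n, Real.log (Tr s (lam (s - 1)) (lam s))) / η (n - 1) := by
        rw [div_eq_mul_inv, div_eq_mul_inv]
        exact mul_le_mul_of_nonpos_left (inv_anti₀ hηn (hη_pred n (by omega)))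
          (hTr_sum n (by omega))
      have hlogz : Real.log (z (n + 1) (lam (n + 1))) / η n =
          Real.log (w (n + 1) (lam (n + 1))) / η n - φ (n + 1) (lab (n + 1) (lam (n + 1))) := by
        rw [hz_step n hn _ (hlam _ hn), Real.log_mul hwpos.ne' (Real.exp_pos _).ne',
          Real.log_exp]
        field_simp
        ring
      rw [Finset.sum_Icc_succ_top (by omega), Finset.sum_Icc_succ_top (by omega),
        Nat.add_sub_cancel, hlogz, add_div]
      linarith
  -- combination
  have hZ_lam : Real.log (z T (lam T)) / η (T - 1) ≤
      Real.log (∑ a ∈ Ω T, z T a) / η (T - 1) :=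
    div_le_div_of_nonneg_right (Real.log_le_log (hz_lam T le_rfl)
      (Finset.single_le_sum (hz_nonneg T le_rfl) (hlam T le_rfl)))
      (hη_pos (T - 1) (by omega)).le
  have hcomp' : Real.log N / η (T - 1) -
      (∑ s ∈ Finset.Icc 1 T, Real.log (Tr s (lam (s - 1)) (lam s))) / η (T - 1) ≤
        W / η T := by
    rw [Real.log_prod fun s hs => (hlamTr s (Finset.mem_Icc.mp hs).1
      (Finset.mem_Icc.mp hs).2).ne'] at hcomp
    rw [← sub_div]
    exact (div_le_div_of_nonneg_right hcomp (hη_pos (T - 1) (by omega)).le).trans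
      (div_le_div_of_nonneg_left hW0.le (hη_pos T le_rfl) (hη_pred T le_rfl))
  set S : ℝ := ∑ t ∈ Finset.Icc 1 T, Δ t ^ 2 with hS
  have hV_S : ∑ t ∈ Finset.Icc 1 T, v t ≤ S := Finset.sum_le_sum fun s hs => by
    obtain ⟨h1, h2⟩ := Finset.mem_Icc.mp hs
    obtain ⟨k, rfl⟩ := Nat.exists_eq_add_of_le' h1
    exact hv_le k h2
  have hfinal_rate : W / η T ≤ Real.sqrt (W * S) := by
    have hVT : 0 < V T := by obtain ⟨k, rfl⟩ := Nat.exists_eq_add_of_le' hT; exact hV_pos k le_rfl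
    have hDT : 0 < D T := by obtain ⟨k, rfl⟩ := Nat.exists_eq_add_of_le' hT; exact hD_pos k le_rfl
    have hVS : V T ≤ S := by rw [hV T hT le_rfl]; exact hV_S
    have hSpos : 0 < S := hVT.trans_le hVS
    have hD_S : D T ≤ Real.sqrt S := by
      rw [hD T hT le_rfl]
      refine Finset.sup'_le _ _ fun s hs => ?_
      obtain ⟨h1, h2⟩ := Finset.mem_Icc.mp hs
      obtain ⟨k, rfl⟩ := Nat.exists_eq_add_of_le' h1
      rw [hrange k h2]
      exact Real.le_sqrt_of_sq_le
        (Finset.single_le_sum (f := fun t => Δ t ^ 2) (fun t _ => sq_nonneg _) hs)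
    have hsW := Real.sqrt_pos.mpr hW0
    have hsS := Real.sqrt_pos.mpr hSpos
    rw [Real.sqrt_mul hW0.le, div_le_comm₀ (hη_pos T le_rfl) (mul_pos hsW hsS),
      hη T hT le_rfl]
    have hWS : W / (Real.sqrt W * Real.sqrt S) = Real.sqrt W / Real.sqrt S := by
      nth_rewrite 1 [← Real.mul_self_sqrt hW0.le]
      field_simp
    refine le_min ?_ ?_
    · rw [hWS]
      exact div_le_div_of_nonneg_left hsW.le (Real.sqrt_pos.mpr hVT) (Real.sqrt_le_sqrt hVS)
    · refine div_le_div_of_nonneg_left hW0.le hDT (hD_S.trans ?_)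
      exact le_mul_of_one_le_left hsS.le (Real.one_le_sqrt.mpr hW)
  have hsecond : ∑ s ∈ Finset.Icc 1 T, η s * v s ≤ 2 * Real.sqrt (W * S) := by
    calc ∑ s ∈ Finset.Icc 1 T, η s * v s
        ≤ ∑ s ∈ Finset.Icc 1 T, Real.sqrt W * (v s / Real.sqrt (V s)) := by
          refine Finset.sum_le_sum fun s hs => ?_
          obtain ⟨h1, h2⟩ := Finset.mem_Icc.mp hs
          obtain ⟨k, rfl⟩ := Nat.exists_eq_add_of_le' h1
          rw [← mul_div_assoc, mul_div_right_comm, hη (k + 1) h1 h2]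
          exact mul_le_mul_of_nonneg_right (min_le_left _ _) (hv_nonneg k h2)
      _ ≤ Real.sqrt W * (2 * Real.sqrt (∑ s ∈ Finset.Icc 1 T, v s)) := by
          rw [← Finset.mul_sum]
          refine mul_le_mul_of_nonneg_left (sum_div_sqrt_le (fun s hs => ?_) fun s hs => ?_)
            (Real.sqrt_nonneg _)
          · obtain ⟨h1, h2⟩ := Finset.mem_Icc.mp hs
            obtain ⟨k, rfl⟩ := Nat.exists_eq_add_of_le' h1
            exact hv_nonneg k h2
          · obtain ⟨h1, h2⟩ := Finset.mem_Icc.mp hs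
            exact hV s h1 h2
      _ ≤ Real.sqrt W * (2 * Real.sqrt S) := by gcongr
      _ = 2 * Real.sqrt (W * S) := by rw [Real.sqrt_mul hW0.le]; ring
  have hregret : ∑ t ∈ Finset.Icc 1 T, ((∑ m, p t m * l t m) - l t (lab t (lam t))) =
      ∑ t ∈ Finset.Icc 1 T, ∑ m, p t m * φ t m -
        ∑ t ∈ Finset.Icc 1 T, φ t (lab t (lam t)) := by
    rw [← Finset.sum_sub_distrib]
    refine Finset.sum_congr rfl fun s hs => ?_
    obtain ⟨h1, h2⟩ := Finset.mem_Icc.mp hs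
    have hsum : ∑ m, p s m = 1 := by
      obtain ⟨k, rfl⟩ := Nat.exists_eq_add_of_le' h1
      exact hp_sum k h2
    simp only [hφ s h1 h2, mul_sub, Finset.sum_sub_distrib, ← Finset.sum_mul, hsum]
    ring
  have hup := hupper T le_rfl
  have hlo := hlower T le_rfl
  have hη0_pos := hη_pos 0 (by omega)
  have h1 : (1 / η (T - 1) - 1 / η 0) * Real.log N ≤ Real.log N / η (T - 1) := by
    have : 0 ≤ 1 / η 0 * Real.log N := by positivity
    linarith [sub_mul (1 / η (T - 1)) (1 / η 0) (Real.log N),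
      one_div_mul_eq_div (η (T - 1)) (Real.log N)]
  have h2 : W * (1 / η T - 1 / η 0) ≤ W / η T := by
    have : 0 ≤ W * (1 / η 0) := by positivity
    linarith [mul_sub W (1 / η T) (1 / η 0), mul_one_div W (η T)]
  rw [hregret]
  linarith [Real.sqrt_nonneg (W * S)]
end
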